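/- arXiv:0812.4871 — 7 statements merged into one kernel-verified Lean document; each statement's English description precedes it below -/
import Mathlib

section
/- In ℂ^{3×6}, the set of matrices M such that det(M_{{1,2,6}}) = det(M_{{1,3,5}}) = det(M_{{2,3,4}}) = det(M_{{4,5,6}}) = 0 is exactly the union of the Menelaus matrix matroid variety Y_{C_M} and the set {M ∈ ℂ^{3×6} : rank(M) ≤ 2}. -/
/-- The dimension of the span of the columns of `M` indexed by `V`,
i.e. the rank of the submatrix `M_V`. -/
noncomputable def colSpanDim (M : Matrix (Fin 3) (Fin 6) ℂ) (V : Set (Fin 6)) : ℕ :=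
  Module.finrank ℂ (Submodule.span ℂ ((fun j => fun i => M i j) '' V))

/-- The Menelaus rank function on subsets of the six column indices (here `0,…,5`
stand for the points `P1,…,P6`): `r(V) = |V|` for `|V| ≤ 2`, `r(V) = 2` for the four
collinear triples `{1,2,6}, {1,3,5}, {2,3,4}, {4,5,6}`, and `r(V) = 3` otherwise. -/
noncomputable def menRank (V : Set (Fin 6)) : ℕ := by
  classical
  exact if V.ncard ≤ 2 then V.ncard
  else if V = ({0, 1, 5} : Set (Fin 6)) ∨ V = ({0, 2, 4} : Set (Fin 6)) ∨
          V = ({1, 2, 3} : Set (Fin 6)) ∨ V = ({3, 4, 5} : Set (Fin 6)) then 2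
  else 3

/-- `X_{C_M}`: matrices whose column rank function is the Menelaus rank function. -/
def Xcm : Set (Matrix (Fin 3) (Fin 6) ℂ) :=
  {M | ∀ V : Set (Fin 6), colSpanDim M V = menRank V}

/-- `Y_{C_M}`, the Menelaus matrix matroid variety: the Zariski closure of `X_{C_M}`. -/
def Ycm : Set (Matrix (Fin 3) (Fin 6) ℂ) :=
  {M | ∀ p : MvPolynomial (Fin 3 × Fin 6) ℂ,
    (∀ N ∈ Xcm, MvPolynomial.eval (fun q => N q.1 q.2) p = 0) →
    MvPolynomial.eval (fun q => M q.1 q.2) p = 0}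

open Matrix Filter Topology

/-- The four collinear triples of the Menelaus configuration. -/
def menelausLines : Finset (Finset (Fin 6)) := {{0, 1, 5}, {0, 2, 4}, {1, 2, 3}, {3, 4, 5}}

theorem menRank_coe (V : Finset (Fin 6)) :
    menRank (V : Set (Fin 6)) =
      if V.card ≤ 2 then V.card else if V ∈ menelausLines then 2 else 3 := by
  have h : V ∈ menelausLines ↔ ((V : Set (Fin 6)) = {0, 1, 5} ∨ (V : Set (Fin 6)) = {0, 2, 4} ∨
      (V : Set (Fin 6)) = {1, 2, 3} ∨ (V : Set (Fin 6)) = {3, 4, 5}) := by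
    simp only [menelausLines, Finset.mem_insert, Finset.mem_singleton, ← Finset.coe_inj,
      Finset.coe_insert, Finset.coe_singleton]
  simp only [menRank, Set.ncard_coe_finset, h]

theorem range_vecCons_three (a b c : Fin 6) :
    Set.range ![a, b, c] = (({a, b, c} : Finset (Fin 6)) : Set (Fin 6)) := by
  ext x; simp [or_comm, or_left_comm, eq_comm]

theorem colSpanDim_mono (M : Matrix (Fin 3) (Fin 6) ℂ) {U V : Set (Fin 6)} (h : U ⊆ V) :
    colSpanDim M U ≤ colSpanDim M V :=
  Submodule.finrank_mono (Submodule.span_mono (Set.image_mono h))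

theorem colSpanDim_le_three (M : Matrix (Fin 3) (Fin 6) ℂ) (V : Set (Fin 6)) :
    colSpanDim M V ≤ 3 :=
  (Submodule.finrank_le _).trans (by simp)

theorem colSpanDim_range (M : Matrix (Fin 3) (Fin 6) ℂ) (s : Fin 3 → Fin 6) :
    colSpanDim M (Set.range s) = (M.submatrix id s).rank := by
  rw [Matrix.rank_eq_finrank_span_cols, colSpanDim, ← Set.range_comp]
  rfl

theorem rank_eq_three_iff (A : Matrix (Fin 3) (Fin 3) ℂ) : A.rank = 3 ↔ A.det ≠ 0 := by
  rw [← isUnit_iff_ne_zero, ← Matrix.isUnit_iff_isUnit_det,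
    ← Matrix.linearIndependent_cols_iff_isUnit, linearIndependent_iff_card_eq_finrank_span,
    Matrix.rank_eq_finrank_span_cols]
  simp [eq_comm, Set.finrank]

theorem linearIndepOn_of_det_ne_zero (M : Matrix (Fin 3) (Fin 6) ℂ) {s : Fin 3 → Fin 6}
    (h : (M.submatrix id s).det ≠ 0) :
    LinearIndepOn ℂ (fun j i => M i j) (Set.range s) := by
  have h' : LinearIndependent ℂ (M.submatrix id s).col := by
    rw [Matrix.linearIndependent_cols_iff_isUnit, Matrix.isUnit_iff_isUnit_det]
    exact h.isUnit
  have : LinearIndepOn ℂ ((fun j i => M i j) ∘ s) Set.univ := linearIndepOn_univ_iff.2 h'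
  simpa using this.image_of_comp

theorem colSpanDim_eq_card (M : Matrix (Fin 3) (Fin 6) ℂ) {V : Finset (Fin 6)}
    (h : LinearIndepOn ℂ (fun j i => M i j) (V : Set (Fin 6))) :
    colSpanDim M V = V.card := by
  rw [colSpanDim, Set.image_eq_range]
  exact (finrank_span_eq_card h).trans (by simp)

theorem exists_triple_superset : ∀ V : Finset (Fin 6), V.card ≤ 2 →
    ∃ a b c, a < b ∧ b < c ∧ ({a, b, c} : Finset (Fin 6)) ∉ menelausLines ∧ V ⊆ {a, b, c} := by
  decide +kernel

theorem exists_triple_subset : ∀ V : Finset (Fin 6), ¬ V.card ≤ 2 → V ∉ menelausLines →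
    ∃ a b c, a < b ∧ b < c ∧ ({a, b, c} : Finset (Fin 6)) ∉ menelausLines ∧ {a, b, c} ⊆ V := by
  decide +kernel

theorem exists_triple_eq : ∀ V : Finset (Fin 6), V ∈ menelausLines →
    ∃ a b c, a < b ∧ b < c ∧ {a, b, c} = V ∧ ({a, b} : Finset (Fin 6)).card = 2 := by
  decide +kernel

/-- A matrix whose vanishing maximal minors are exactly those of the four lines realises the
Menelaus configuration. -/
theorem mem_Xcm_of_det (M : Matrix (Fin 3) (Fin 6) ℂ)
    (hM : ∀ a b c, a < b → b < c →
      ((M.submatrix id ![a, b, c]).det = 0 ↔ ({a, b, c} : Finset (Fin 6)) ∈ menelausLines)) :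
    M ∈ Xcm := by
  have small : ∀ V : Finset (Fin 6), V.card ≤ 2 → colSpanDim M V = V.card := by
    intro V hV
    obtain ⟨a, b, c, hab, hbc, hT, hVT⟩ := exists_triple_superset V hV
    have h := linearIndepOn_of_det_ne_zero M (mt (hM a b c hab hbc).1 hT)
    rw [range_vecCons_three] at h
    exact colSpanDim_eq_card M (h.mono (Finset.coe_subset.2 hVT))
  intro V
  lift V to Finset (Fin 6) using V.toFinite
  rw [menRank_coe]
  split_ifs with h2 hl
  · exact small V h2
  · obtain ⟨a, b, c, hab, hbc, rfl, hU⟩ := exists_triple_eq V hl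
    have hlt : colSpanDim M (({a, b, c} : Finset (Fin 6)) : Set (Fin 6)) ≠ 3 := by
      rw [← range_vecCons_three, colSpanDim_range, ne_eq, rank_eq_three_iff, not_not]
      exact (hM a b c hab hbc).2 hl
    have hle := colSpanDim_le_three M (({a, b, c} : Finset (Fin 6)) : Set (Fin 6))
    have hge : colSpanDim M (({a, b} : Finset (Fin 6)) : Set (Fin 6)) ≤
        colSpanDim M (({a, b, c} : Finset (Fin 6)) : Set (Fin 6)) :=
      colSpanDim_mono M (Finset.coe_subset.2 (by grind))
    rw [small _ hU.le, hU] at hge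
    omega
  · obtain ⟨a, b, c, hab, hbc, hT, hTV⟩ := exists_triple_subset V h2 hl
    have h3 := (rank_eq_three_iff _).2 (mt (hM a b c hab hbc).1 hT)
    rw [← colSpanDim_range, range_vecCons_three] at h3
    exact le_antisymm (colSpanDim_le_three M _)
      (h3.symm.le.trans (colSpanDim_mono M (Finset.coe_subset.2 hTV)))

theorem det_eq_zero_of_mem_Xcm {M : Matrix (Fin 3) (Fin 6) ℂ} (hM : M ∈ Xcm) (a b c : Fin 6)
    (h : ({a, b, c} : Finset (Fin 6)) ∈ menelausLines) :
    (M.submatrix id ![a, b, c]).det = 0 := by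
  have hc : ∀ V ∈ menelausLines, V.card = 3 := by decide
  have := hM (Set.range ![a, b, c])
  rw [colSpanDim_range, range_vecCons_three, menRank_coe, if_neg (by rw [hc _ h]; omega),
    if_pos h] at this
  by_contra h0
  rw [(rank_eq_three_iff _).2 h0] at this
  omega

theorem det_eq_zero_of_mem_Ycm {M : Matrix (Fin 3) (Fin 6) ℂ} (hM : M ∈ Ycm) (a b c : Fin 6)
    (h : ({a, b, c} : Finset (Fin 6)) ∈ menelausLines) :
    (M.submatrix id ![a, b, c]).det = 0 := by
  have key : ∀ N : Matrix (Fin 3) (Fin 6) ℂ,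
      MvPolynomial.eval (fun q => N q.1 q.2)
        ((Matrix.of fun i j => (MvPolynomial.X (i, j) : MvPolynomial (Fin 3 × Fin 6) ℂ)).submatrix
          id ![a, b, c]).det = (N.submatrix id ![a, b, c]).det := by
    intro N
    rw [RingHom.map_det]
    congr 1
    ext i j
    simp
  rw [← key]
  refine hM _ fun N hN => ?_
  rw [key]
  exact det_eq_zero_of_mem_Xcm hN a b c h

/-- Polynomials are continuous, so the Euclidean closure lies in the Zariski closure. -/
theorem closure_Xcm_subset_Ycm : closure Xcm ⊆ Ycm := by
  refine closure_minimal (fun M hM p hp => hp M hM) ?_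
  simp only [Ycm, Set.ofPred_forall]
  refine isClosed_iInter fun p => isClosed_iInter fun _ => isClosed_eq ?_ continuous_const
  exact (MvPolynomial.continuous_eval p).comp (by fun_prop)

/-- Each point of the configuration is the intersection of two of the four lines; this is the
first of them. -/
def src : Fin 6 → Fin 4 := ![0, 0, 1, 2, 1, 0]

/-- The second line through each point of the configuration. -/
def tgt : Fin 6 → Fin 4 := ![1, 2, 2, 3, 3, 3]

/-- The point lying on the two lines which avoid a given point. -/
def opp : Fin 6 → Fin 6 := ![3, 4, 5, 0, 1, 2]

/-- The matrix whose columns are scaled intersection points of four lines. -/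
noncomputable def intersections (l : Fin 4 → Fin 3 → ℂ) (c : Fin 6 → ℂ) :
    Matrix (Fin 3) (Fin 6) ℂ :=
  Matrix.of fun i j => c j * (l (src j) ⨯₃ l (tgt j)) i

/-- The determinant of three of the four lines. -/
noncomputable def lineDet (l : Fin 4 → Fin 3 → ℂ) (i j k : Fin 4) : ℂ :=
  l i ⬝ᵥ l j ⨯₃ l k

theorem det_intersections (l : Fin 4 → Fin 3 → ℂ) (c : Fin 6 → ℂ) (x y z : Fin 6) :
    ((intersections l c).submatrix id ![x, y, z]).det = c x * c y * c z *
      (lineDet l (src y) (tgt y) (tgt z) * lineDet l (src x) (tgt x) (src z) -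
        lineDet l (src y) (tgt y) (src z) * lineDet l (src x) (tgt x) (tgt z)) := by
  simp only [lineDet, dotProduct, Fin.sum_univ_three]
  simp [Matrix.det_fin_three, intersections, cross_apply]
  ring

theorem injective_dichotomy : ∀ x y z : Fin 6, x < y → y < z →
    if ({x, y, z} : Finset (Fin 6)) ∈ menelausLines then
      ¬ ([src y, tgt y, tgt z].Nodup ∧ [src x, tgt x, src z].Nodup) ∧
      ¬ ([src y, tgt y, src z].Nodup ∧ [src x, tgt x, tgt z].Nodup)
    else
      Xor ([src y, tgt y, tgt z].Nodup ∧ [src x, tgt x, src z].Nodup)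
        ([src y, tgt y, src z].Nodup ∧ [src x, tgt x, tgt z].Nodup) := by
  unfold Xor
  decide +kernel

theorem lineDet_eq_zero_of_not_nodup (l : Fin 4 → Fin 3 → ℂ) {i j k : Fin 4}
    (h : ¬ [i, j, k].Nodup) : lineDet l i j k = 0 := by
  have : i = j ∨ i = k ∨ j = k := by
    by_contra! h'
    simp_all
  rcases this with rfl | rfl | rfl <;> simp [lineDet]

theorem intersections_mem_Xcm {l : Fin 4 → Fin 3 → ℂ} {c : Fin 6 → ℂ}
    (hl : ∀ i j k, [i, j, k].Nodup → lineDet l i j k ≠ 0) (hc : ∀ j, c j ≠ 0) :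
    intersections l c ∈ Xcm := by
  have hD : ∀ i j k, lineDet l i j k = 0 ↔ ¬ [i, j, k].Nodup := fun i j k =>
    ⟨fun h h' => hl i j k h' h, lineDet_eq_zero_of_not_nodup l⟩
  have hD2 : ∀ i j k i' j' k', lineDet l i j k * lineDet l i' j' k' = 0 ↔
      ¬ ([i, j, k].Nodup ∧ [i', j', k'].Nodup) := fun i j k i' j' k' => by
    rw [mul_eq_zero, hD, hD, not_and_or]
  refine mem_Xcm_of_det _ fun x y z hxy hyz => ?_
  have h := injective_dichotomy x y z hxy hyz
  rw [det_intersections, mul_eq_zero,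
    or_iff_right (mul_ne_zero (mul_ne_zero (hc x) (hc y)) (hc z))]
  split_ifs at h with hT
  · simp only [hT, iff_true]
    rw [(hD2 _ _ _ _ _ _).2 h.1, (hD2 _ _ _ _ _ _).2 h.2, sub_zero]
  · simp only [hT, iff_false]
    rcases h with ⟨h1, h2⟩ | ⟨h1, h2⟩
    · rw [(hD2 _ _ _ _ _ _).2 h2, sub_zero]
      exact mt (hD2 _ _ _ _ _ _).1 (not_not.2 h1)
    · rw [(hD2 _ _ _ _ _ _).2 h2, zero_sub, neg_eq_zero]
      exact mt (hD2 _ _ _ _ _ _).1 (not_not.2 h1)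

theorem eventually_eval_ne_zero {p : Polynomial ℂ} (hp : p ≠ 0) (a : ℂ) :
    ∀ᶠ t in 𝓝[≠] a, p.eval t ≠ 0 := by
  refine Filter.Eventually.filter_mono (nhdsNE_le_cofinite a) ?_
  rw [Filter.eventually_cofinite]
  simpa using Polynomial.finite_setOfPred_isRoot hp

theorem eventually_lineDet_ne_zero (l m : Fin 4 → Fin 3 → ℂ) {i j k : Fin 4}
    (h : lineDet m i j k ≠ 0) :
    ∀ᶠ t : ℂ in 𝓝[≠] 0, lineDet (fun a => l a + t • m a) i j k ≠ 0 := by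
  let p : Polynomial ℂ := Polynomial.C (lineDet m i j k) * Polynomial.X ^ 3 +
    Polynomial.C (l i ⬝ᵥ m j ⨯₃ m k + m i ⬝ᵥ l j ⨯₃ m k + m i ⬝ᵥ m j ⨯₃ l k) * Polynomial.X ^ 2 +
    Polynomial.C (l i ⬝ᵥ l j ⨯₃ m k + m i ⬝ᵥ l j ⨯₃ l k + l i ⬝ᵥ m j ⨯₃ l k) * Polynomial.X +
    Polynomial.C (lineDet l i j k)
  have hp : p ≠ 0 := fun h0 => h (by
    simpa [p, -map_add, Polynomial.coeff_X, Polynomial.coeff_C] using congrArg (Polynomial.coeff · 3) h0)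
  filter_upwards [eventually_eval_ne_zero hp 0] with t ht
  convert ht using 1
  simp only [p, lineDet, dotProduct, Fin.sum_univ_three]
  simp [cross_apply]
  ring

theorem exists_generic_lines :
    ∃ m : Fin 4 → Fin 3 → ℂ, ∀ i j k, [i, j, k].Nodup → lineDet m i j k ≠ 0 := by
  refine ⟨fun i => ![1, (i : ℂ), (i : ℂ) ^ 2], fun i j k h => ?_⟩
  have h' : ((j : ℕ) : ℂ) - i ≠ 0 ∧ ((k : ℕ) : ℂ) - i ≠ 0 ∧ ((k : ℕ) : ℂ) - j ≠ 0 := by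
    simp only [sub_ne_zero, ne_eq, Nat.cast_inj, Fin.val_inj]
    grind
  convert mul_ne_zero (mul_ne_zero h'.1 h'.2.1) h'.2.2 using 1
  simp only [lineDet, dotProduct, Fin.sum_univ_three]
  simp [cross_apply]
  ring

theorem intersections_mem_closure (l : Fin 4 → Fin 3 → ℂ) (c : Fin 6 → ℂ) :
    intersections l c ∈ closure Xcm := by
  obtain ⟨m, hm⟩ := exists_generic_lines
  have hcont : Continuous fun t : ℂ =>
      intersections (fun a => l a + t • m a) (fun j => c j + t) := by
    unfold intersections
    simp only [cross_apply]
    refine continuous_matrix fun i j => ?_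
    fin_cases i <;> simp <;> fun_prop
  have hlim := (hcont.tendsto 0).mono_left (nhdsWithin_le_nhds (s := {0}ᶜ))
  simp only [zero_smul, add_zero] at hlim
  refine mem_closure_of_tendsto hlim ?_
  have h1 : ∀ᶠ t : ℂ in 𝓝[≠] 0, ∀ i j k, [i, j, k].Nodup →
      lineDet (fun a => l a + t • m a) i j k ≠ 0 := by
    simp only [Filter.eventually_all]
    exact fun i j k h => eventually_lineDet_ne_zero l m (hm i j k h)
  have h2 : ∀ᶠ t : ℂ in 𝓝[≠] 0, ∀ j, c j + t ≠ 0 := by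
    rw [Filter.eventually_all]
    intro j
    simpa [add_comm] using eventually_eval_ne_zero (Polynomial.X_add_C_ne_zero (c j)) 0
  filter_upwards [h1, h2] with t ht1 ht2 using intersections_mem_Xcm ht1 ht2

theorem dot_eq_zero_of_cross_eq_zero {a b p : Fin 3 → ℂ} (h : a ⨯₃ b = 0) (ha : a ≠ 0)
    (hp : p ⬝ᵥ a = 0) : p ⬝ᵥ b = 0 := by
  have := cross_cross_eq_smul_sub_smul' p a b
  rw [h, dotProduct_comm a p, hp, map_zero, zero_smul, sub_zero] at this
  exact (smul_eq_zero.1 this.symm).resolve_right ha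

theorem exists_eq_smul_cross {a b p : Fin 3 → ℂ} (hab : a ⨯₃ b ≠ 0) (ha : p ⬝ᵥ a = 0)
    (hb : p ⬝ᵥ b = 0) : ∃ c : ℂ, p = c • (a ⨯₃ b) := by
  have h := cross_cross_eq_smul_sub_smul' p a b
  rw [dotProduct_comm a p, ha, hb, zero_smul, zero_smul, sub_zero] at h
  generalize a ⨯₃ b = n at hab h
  obtain ⟨k, hk⟩ := Function.ne_iff.1 hab
  rw [cross_apply] at h
  have h0 := congrFun h 0
  have h1 := congrFun h 1
  have h2 := congrFun h 2
  simp only [Pi.zero_apply, cons_val_zero, cons_val_one, cons_val] at h0 h1 h2 hk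
  refine ⟨p k / n k, funext fun i => ?_⟩
  simp only [Pi.smul_apply, smul_eq_mul]
  field_simp
  fin_cases i <;> fin_cases k <;> simp <;> grind

theorem exists_dot_eq_zero_cross_ne_zero {l p : Fin 3 → ℂ} (hl : l ≠ 0) (h : p ⬝ᵥ l = 0) :
    ∃ m : Fin 3 → ℂ, p ⬝ᵥ m = 0 ∧ m ⨯₃ l ≠ 0 := by
  by_contra! H
  obtain ⟨k, hk⟩ := Function.ne_iff.1 hl
  have hp : p = 0 := by
    have h1 := H (p ⨯₃ Pi.single k 1) (dot_self_cross _ _)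
    rw [cross_cross_eq_smul_sub_smul, h, zero_smul, zero_sub, neg_eq_zero,
      smul_eq_zero, single_one_dotProduct] at h1
    exact h1.resolve_left hk
  subst hp
  refine hl (funext fun i => ?_)
  have h1 := H ![1, 0, 0] (zero_dotProduct _)
  have h2 := H ![0, 1, 0] (zero_dotProduct _)
  rw [cross_apply] at h1 h2
  have h10 := congrFun h1 1
  have h11 := congrFun h1 2
  have h20 := congrFun h2 0
  have h21 := congrFun h2 2
  simp at h10 h11 h20 h21
  fin_cases i <;> simp [*]

/-- If the lines through the columns of `M` can be moved along `d` so that they become pairwise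
distinct, while each column that is not determined by its lines stays on them, then `M` is a limit
of Menelaus configurations. -/
theorem mem_closure_of_direction {M : Matrix (Fin 3) (Fin 6) ℂ} {l d : Fin 4 → Fin 3 → ℂ}
    (hs : ∀ e, M.col e ⬝ᵥ l (src e) = 0) (ht : ∀ e, M.col e ⬝ᵥ l (tgt e) = 0)
    (hd : ∀ e, l (src e) ⨯₃ l (tgt e) = 0 → M.col e ⬝ᵥ d (src e) = 0 ∧ d (tgt e) = 0 ∧
      d (src e) ⨯₃ l (tgt e) ≠ 0) :
    M ∈ closure Xcm := by
  have hc : ∀ e, ∃ c : ℂ, l (src e) ⨯₃ l (tgt e) ≠ 0 →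
      M.col e = c • (l (src e) ⨯₃ l (tgt e)) := fun e => by
    by_cases h : l (src e) ⨯₃ l (tgt e) = 0
    · exact ⟨0, fun h' => absurd h h'⟩
    · obtain ⟨c, hc⟩ := exists_eq_smul_cross h (hs e) (ht e)
      exact ⟨c, fun _ => hc⟩
  choose c hc using hc
  let L : ℂ → Fin 4 → Fin 3 → ℂ := fun t a => l a + t • d a
  let col : ℂ → Fin 6 → Fin 3 → ℂ := fun t e =>
    if l (src e) ⨯₃ l (tgt e) = 0 then M.col e else c e • (L t (src e) ⨯₃ L t (tgt e))
  have hLcont : ∀ e, Continuous fun t => L t (src e) ⨯₃ L t (tgt e) := fun e => by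
    simp only [cross_apply, L]
    refine continuous_pi fun i => ?_
    fin_cases i <;> simp <;> fun_prop
  have hcol0 : col 0 = M.col := by
    funext e
    by_cases h : l (src e) ⨯₃ l (tgt e) = 0
    · simp [col, h]
    · simp [col, h, L, hc e h]
  have hcont : Continuous fun t => (Matrix.of (col t))ᵀ := by
    refine Continuous.matrix_transpose (continuous_pi fun e => ?_)
    change Continuous fun t => col t e
    by_cases h : l (src e) ⨯₃ l (tgt e) = 0
    · simp only [col, h, if_true, continuous_const]
    · simp only [col, h, if_false]
      exact (hLcont e).const_smul (c e)
  have hlim := (hcont.tendsto 0).mono_left (nhdsWithin_le_nhds (s := {0}ᶜ))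
  rw [hcol0] at hlim
  rw [← closure_closure]
  refine mem_closure_of_tendsto hlim ?_
  have hne : ∀ᶠ t in 𝓝[≠] (0 : ℂ), ∀ e, L t (src e) ⨯₃ L t (tgt e) ≠ 0 := by
    rw [Filter.eventually_all]
    intro e
    by_cases h : l (src e) ⨯₃ l (tgt e) = 0
    · filter_upwards [self_mem_nhdsWithin] with t ht0
      obtain ⟨-, h2, h3⟩ := hd e h
      simpa [L, h2, h] using ⟨ht0, h3⟩
    · exact ((hLcont e).tendsto 0).mono_left nhdsWithin_le_nhds |>.eventually_ne (by simpa [L])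
  filter_upwards [hne] with t hne
  have hex : ∀ e, ∃ k : ℂ, col t e = k • (L t (src e) ⨯₃ L t (tgt e)) := fun e => by
    by_cases h : l (src e) ⨯₃ l (tgt e) = 0
    · obtain ⟨h1, h2, -⟩ := hd e h
      simp only [col, h, if_true]
      refine exists_eq_smul_cross (hne e) ?_ ?_
      · simp [L, hs, h1]
      · simp [L, ht, h2]
    · exact ⟨c e, by simp [col, h]⟩
  choose k hk using hex
  convert intersections_mem_closure (L t) k using 1
  ext i e
  simp [intersections, hk]

theorem src_eq_or_tgt_eq : ∀ e f : Fin 6, e ≠ opp f →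
    src e = src f ∨ src e = tgt f ∨ tgt e = src f ∨ tgt e = tgt f := by
  decide

theorem src_tgt_cross : ∀ e f : Fin 6, e ≠ f → e ≠ opp f →
    (src e = src f ∨ src e = tgt f) ∧ (tgt e = src (opp f) ∨ tgt e = tgt (opp f)) ∨
    (tgt e = src f ∨ tgt e = tgt f) ∧ (src e = src (opp f) ∨ src e = tgt (opp f)) := by
  decide

theorem endpoints_ne : ∀ f : Fin 6, tgt f ≠ src f ∧ tgt f ≠ src (opp f) ∧
    src (opp f) ≠ src f ∧ tgt (opp f) ≠ src f ∧ tgt (opp f) ≠ src (opp f) := by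
  decide

/-- A matrix of rank three whose columns lie on four lines is a limit of Menelaus configurations:
at most one pair of opposite columns has coinciding lines, and these can be rotated apart about
the columns on them. -/
theorem mem_closure_of_lines {M : Matrix (Fin 3) (Fin 6) ℂ} {l : Fin 4 → Fin 3 → ℂ}
    (hl : ∀ a, l a ≠ 0) (hs : ∀ e, M.col e ⬝ᵥ l (src e) = 0)
    (ht : ∀ e, M.col e ⬝ᵥ l (tgt e) = 0)
    (hM : ∀ v, v ≠ 0 → ∃ e, M.col e ⬝ᵥ v ≠ 0) : M ∈ closure Xcm := by
  by_cases hpar : ∃ f, l (src f) ⨯₃ l (tgt f) = 0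
  swap
  · push Not at hpar
    exact mem_closure_of_direction (d := 0) hs ht fun e h => absurd h (hpar e)
  obtain ⟨f, hf⟩ := hpar
  have hf' : l (tgt f) ⨯₃ l (src f) = 0 := by rw [← cross_anticomm, hf, neg_zero]
  have hst : ∀ p : Fin 3 → ℂ, p ⬝ᵥ l (src f) = 0 ↔ p ⬝ᵥ l (tgt f) = 0 := fun p =>
    ⟨dot_eq_zero_of_cross_eq_zero hf (hl _), dot_eq_zero_of_cross_eq_zero hf' (hl _)⟩
  have hoff : M.col (opp f) ⬝ᵥ l (src f) ≠ 0 := by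
    obtain ⟨e, he⟩ := hM _ (hl (src f))
    by_cases h : e = opp f
    · rwa [h] at he
    · refine absurd ?_ he
      rcases src_eq_or_tgt_eq e f h with h | h | h | h
      · exact h ▸ hs e
      · exact (hst _).2 (h ▸ hs e)
      · exact h ▸ ht e
      · exact (hst _).2 (h ▸ ht e)
  have hoff' : M.col (opp f) ⬝ᵥ l (tgt f) ≠ 0 := mt (hst _).2 hoff
  have hcross : ∀ e, e ≠ f → e ≠ opp f → l (src e) ⨯₃ l (tgt e) ≠ 0 := by
    intro e h1 h2 h
    have h' : l (tgt e) ⨯₃ l (src e) = 0 := by rw [← cross_anticomm, h, neg_zero]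
    have hso := hs (opp f)
    have hto := ht (opp f)
    rcases src_tgt_cross e f h1 h2 with ⟨h3, h4⟩ | ⟨h3, h4⟩
    · have : M.col (opp f) ⬝ᵥ l (src e) = 0 :=
        dot_eq_zero_of_cross_eq_zero h' (hl _) (by rcases h4 with h4 | h4 <;> rwa [h4])
      rcases h3 with h3 | h3 <;> rw [h3] at this <;> contradiction
    · have : M.col (opp f) ⬝ᵥ l (tgt e) = 0 :=
        dot_eq_zero_of_cross_eq_zero h (hl _) (by rcases h4 with h4 | h4 <;> rwa [h4])
      rcases h3 with h3 | h3 <;> rw [h3] at this <;> contradiction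
  obtain ⟨m, hm, hm'⟩ := exists_dot_eq_zero_cross_ne_zero (hl (tgt f)) (ht f)
  obtain ⟨n, hn, hn'⟩ := exists_dot_eq_zero_cross_ne_zero (hl (tgt (opp f))) (ht (opp f))
  obtain ⟨hne1, hne2, hne3, hne4, hne5⟩ := endpoints_ne f
  refine mem_closure_of_direction
    (d := fun a => if a = src f then m else if a = src (opp f) then n else 0) hs ht fun e he => ?_
  by_cases h1 : e = f
  · subst h1
    simpa [hne1, hne2] using ⟨hm, hm'⟩
  by_cases h2 : e = opp f
  · subst h2
    simpa [hne3, hne4, hne5] using ⟨hn, hn'⟩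
  exact absurd he (hcross e h1 h2)

theorem exists_col_dot_ne_zero {M : Matrix (Fin 3) (Fin 6) ℂ} (hM : ¬ M.rank ≤ 2)
    (v : Fin 3 → ℂ) (hv : v ≠ 0) : ∃ e, M.col e ⬝ᵥ v ≠ 0 := by
  by_contra! h
  have hrow : LinearIndependent ℂ M.row := by
    rw [linearIndependent_iff_card_le_finrank_span, Set.finrank, ← rank_eq_finrank_span_row]
    simp
    omega
  have := Matrix.vecMul_injective_iff.2 hrow
  refine hv (this (?_ : v ᵥ* M = 0 ᵥ* M))
  rw [zero_vecMul]
  funext e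
  exact (dotProduct_comm _ _).trans (h e)

theorem exists_line_of_det_eq_zero {M : Matrix (Fin 3) (Fin 6) ℂ} {s : Fin 3 → Fin 6}
    (h : (M.submatrix id s).det = 0) :
    ∃ v : Fin 3 → ℂ, v ≠ 0 ∧ ∀ i, M.col (s i) ⬝ᵥ v = 0 := by
  obtain ⟨v, hv, h0⟩ := Matrix.exists_vecMul_eq_zero_iff.2 h
  refine ⟨v, hv, fun i => ?_⟩
  rw [dotProduct_comm]
  exact congrFun h0 i

theorem det_eq_zero_of_rank_le_two {M : Matrix (Fin 3) (Fin 6) ℂ} (h : M.rank ≤ 2)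
    (s : Fin 3 → Fin 6) : (M.submatrix id s).det = 0 := by
  by_contra h0
  have := (rank_eq_three_iff _).2 h0
  have := M.rank_submatrix_le id s
  omega

/-- The common zero set of the four "naive" maximal minors of the Menelaus
configuration is the union of `Y_{C_M}` and the rank `≤ 2` locus. -/
theorem naive_eq_menelaus_union_rank_le_two :
    {M : Matrix (Fin 3) (Fin 6) ℂ |
        (M.submatrix id ![0, 1, 5]).det = 0 ∧ (M.submatrix id ![0, 2, 4]).det = 0 ∧
        (M.submatrix id ![1, 2, 3]).det = 0 ∧ (M.submatrix id ![3, 4, 5]).det = 0} =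
      Ycm ∪ {M : Matrix (Fin 3) (Fin 6) ℂ | M.rank ≤ 2} := by
  apply Set.Subset.antisymm
  · rintro M ⟨h0, h1, h2, h3⟩
    refine or_iff_not_imp_right.2 fun hrank => closure_Xcm_subset_Ycm ?_
    obtain ⟨v0, hv0, h0⟩ := exists_line_of_det_eq_zero h0
    obtain ⟨v1, hv1, h1⟩ := exists_line_of_det_eq_zero h1
    obtain ⟨v2, hv2, h2⟩ := exists_line_of_det_eq_zero h2
    obtain ⟨v3, hv3, h3⟩ := exists_line_of_det_eq_zero h3
    refine mem_closure_of_lines (l := ![v0, v1, v2, v3]) ?_ ?_ ?_ (exists_col_dot_ne_zero hrank)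
    · intro a
      fin_cases a <;> assumption
    · intro e
      fin_cases e
      exacts [h0 0, h0 1, h1 1, h2 2, h1 2, h0 2]
    · intro e
      fin_cases e
      exacts [h1 0, h2 0, h2 1, h3 0, h3 1, h3 2]
  · rintro M (hM | hM)
    · exact ⟨det_eq_zero_of_mem_Ycm hM _ _ _ (by decide),
        det_eq_zero_of_mem_Ycm hM _ _ _ (by decide), det_eq_zero_of_mem_Ycm hM _ _ _ (by decide),
        det_eq_zero_of_mem_Ycm hM _ _ _ (by decide)⟩
    · exact ⟨det_eq_zero_of_rank_le_two hM _, det_eq_zero_of_rank_le_two hM _,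
        det_eq_zero_of_rank_le_two hM _, det_eq_zero_of_rank_le_two hM _⟩
end

section
/- There exists a matrix M ∈ ℂ^{3×6} such that det(M_{{1,2,6}}) = det(M_{{1,3,5}}) = det(M_{{2,3,4}}) = det(M_{{4,5,6}}) = 0, yet M does not belong to the Menelaus matrix matroid variety Y_{C_M}. In other words, the inclusion of Y_{C_M} into the common zero set of these four maximal minors is strict. -/
theorem menRank_pair {j k : Fin 6} (h : j ≠ k) : menRank {j, k} = 2 := by
  simp [menRank, Set.ncard_pair h]

theorem menRank_of_ncard_eq_three {V : Set (Fin 6)} (h : V.ncard = 3) :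
    menRank V = if V = ({0, 1, 5} : Set (Fin 6)) ∨ V = ({0, 2, 4} : Set (Fin 6)) ∨
          V = ({1, 2, 3} : Set (Fin 6)) ∨ V = ({3, 4, 5} : Set (Fin 6)) then 2 else 3 := by
  classical
  simp [menRank, h]

/-- If adding the column `l` to two columns `j`, `k` does not increase the rank,
then the column `l` is a linear combination of the columns `j` and `k`. -/
theorem exists_col_eq_of_colSpanDim_eq {N : Matrix (Fin 3) (Fin 6) ℂ} {j k l : Fin 6}
    (h : colSpanDim N {j, k} = colSpanDim N {j, k, l}) :
    ∃ a b : ℂ, ∀ i, N i l = a * N i j + b * N i k := by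
  have hle : ({j, k} : Set (Fin 6)) ⊆ {j, k, l} := by
    intro x hx
    simp only [Set.mem_insert_iff, Set.mem_singleton_iff] at hx ⊢
    tauto
  have hspan := Submodule.eq_of_le_of_finrank_eq
    (Submodule.span_mono (R := ℂ) (Set.image_mono (f := fun j i => N i j) hle)) h
  have hl : (fun i => N i l) ∈
      Submodule.span ℂ ((fun j i => N i j) '' ({j, k} : Set (Fin 6))) := by
    rw [hspan]
    exact Submodule.subset_span ⟨l, by simp, rfl⟩
  rw [Set.image_pair, Submodule.mem_span_pair] at hl
  obtain ⟨a, b, hab⟩ := hl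
  exact ⟨a, b, fun i => by simpa using (congrFun hab i).symm⟩

theorem exists_col_eq_of_mem_Xcm {N : Matrix (Fin 3) (Fin 6) ℂ} (hN : N ∈ Xcm)
    {j k l : Fin 6} (hjk : j ≠ k) (hr : menRank {j, k, l} = 2) :
    ∃ a b : ℂ, ∀ i, N i l = a * N i j + b * N i k :=
  exists_col_eq_of_colSpanDim_eq (by rw [hN, hN, menRank_pair hjk, hr])

theorem linearIndependent_of_mem_Xcm {N : Matrix (Fin 3) (Fin 6) ℂ} (hN : N ∈ Xcm) :
    LinearIndependent ℂ (fun (k : Fin 3) i => N i (![0, 1, 2] k)) := by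
  have hcard : ({0, 1, 2} : Set (Fin 6)).ncard = 3 :=
    Set.ncard_eq_three.2 ⟨0, 1, 2, by decide, by decide, by decide, rfl⟩
  have hr : menRank {0, 1, 2} = 3 := by
    rw [menRank_of_ncard_eq_three hcard, if_neg]
    simp only [Set.ext_iff, Set.mem_insert_iff, Set.mem_singleton_iff]
    decide
  have hrange : Set.range (fun (k : Fin 3) i => N i (![0, 1, 2] k)) =
      (fun j i => N i j) '' ({0, 1, 2} : Set (Fin 6)) := by
    ext v
    simp [Fin.exists_fin_succ, eq_comm]
  rw [linearIndependent_iff_card_eq_finrank_span, Set.finrank, hrange]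
  exact (hN {0, 1, 2}).trans hr |>.symm

/-- The minor of the first two rows of the generic `3 × 6` matrix on the columns `j`, `k`. -/
noncomputable def topMinor (j k : Fin 6) : MvPolynomial (Fin 3 × Fin 6) ℂ :=
  .X (0, j) * .X (1, k) - .X (1, j) * .X (0, k)

/-- The Menelaus relation for the projection of the configuration to the first two rows. -/
noncomputable def menelausPoly : MvPolynomial (Fin 3 × Fin 6) ℂ :=
  topMinor 5 1 * topMinor 0 4 * topMinor 3 2 + topMinor 0 5 * topMinor 4 2 * topMinor 1 3

theorem eval_menelausPoly_of_mem_Xcm {N : Matrix (Fin 3) (Fin 6) ℂ} (hN : N ∈ Xcm) :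
    MvPolynomial.eval (fun q => N q.1 q.2) menelausPoly = 0 := by
  have hcard {j k l : Fin 6} (hjk : j ≠ k) (hjl : j ≠ l) (hkl : k ≠ l) :
      ({j, k, l} : Set (Fin 6)).ncard = 3 :=
    Set.ncard_eq_three.2 ⟨j, k, l, hjk, hjl, hkl, rfl⟩
  obtain ⟨a, b, h5⟩ := exists_col_eq_of_mem_Xcm hN (j := 0) (k := 1) (l := 5) (by decide)
    (by rw [menRank_of_ncard_eq_three (hcard (by decide) (by decide) (by decide))]; simp)
  obtain ⟨c, d, h4⟩ := exists_col_eq_of_mem_Xcm hN (j := 0) (k := 2) (l := 4) (by decide)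
    (by rw [menRank_of_ncard_eq_three (hcard (by decide) (by decide) (by decide))]; simp)
  obtain ⟨e, f, h3⟩ := exists_col_eq_of_mem_Xcm hN (j := 1) (k := 2) (l := 3) (by decide)
    (by rw [menRank_of_ncard_eq_three (hcard (by decide) (by decide) (by decide))]; simp)
  obtain ⟨g, h, h5'⟩ := exists_col_eq_of_mem_Xcm hN (j := 3) (k := 4) (l := 5) (by decide)
    (by rw [menRank_of_ncard_eq_three (hcard (by decide) (by decide) (by decide))]; simp)
  have hcoeff := Fintype.linearIndependent_iff.1 (linearIndependent_of_mem_Xcm hN)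
    ![a - h * c, b - g * e, -(g * f + h * d)] (by
      ext i
      simp only [Fin.sum_univ_three, Pi.add_apply, Pi.smul_apply, smul_eq_mul, Pi.zero_apply,
        Matrix.cons_val]
      linear_combination h5' i - h5 i + g * h3 i + h * h4 i)
  have ha : a - h * c = 0 := hcoeff 0
  have hb : b - g * e = 0 := hcoeff 1
  have hgh : -(g * f + h * d) = 0 := hcoeff 2
  have key : a * d * e + b * c * f = 0 := by
    linear_combination d * e * ha + c * f * hb - c * e * hgh
  simp only [menelausPoly, topMinor, map_add, map_sub, map_mul, MvPolynomial.eval_X, h3, h4, h5]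
  linear_combination (N 0 0 * N 1 1 - N 1 0 * N 0 1) * (N 0 0 * N 1 2 - N 1 0 * N 0 2) *
    (N 0 1 * N 1 2 - N 1 1 * N 0 2) * key

/-- There is a matrix on which the four "naive" maximal minors of the Menelaus
configuration vanish but which does not lie in the Menelaus matrix matroid
variety `Y_{C_M}`: the inclusion of `Y_{C_M}` in the naive zero set is strict. -/
theorem exists_naive_not_mem_menelaus :
    ∃ M : Matrix (Fin 3) (Fin 6) ℂ,
      (M.submatrix id ![0, 1, 5]).det = 0 ∧ (M.submatrix id ![0, 2, 4]).det = 0 ∧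
      (M.submatrix id ![1, 2, 3]).det = 0 ∧ (M.submatrix id ![3, 4, 5]).det = 0 ∧
      M ∉ Ycm := by
  refine ⟨!![1, 0, 0, 1, 0, 1; 0, 1, 1, 0, 1, 0; 0, 0, 0, 0, 0, 0], ?_, ?_, ?_, ?_, fun hM => ?_⟩
  iterate 4 exact Matrix.det_eq_zero_of_row_eq_zero 2 (by simp [Fin.forall_fin_succ])
  have h := hM menelausPoly fun N hN => eval_menelausPoly_of_mem_Xcm hN
  simp [menelausPoly, topMinor] at h
end

section
/- For every matrix M ∈ X_{C_M}, writing x_i = M_{1,i}, y_i = M_{2,i}, z_i = M_{3,i} for i = 1, …, 6, the following degree-5 polynomial expression vanishes: −x5·y1·z3·z6·y2 + x5·y1·z3·z2·y6 + x3·y5·z2·z1·y6 − x5·y3·z2·z1·y6 + z1·y5·z3·x6·y2 − z1·y5·z3·x2·y6 − z3·y5·z2·x6·y1 + z5·y3·z2·x6·y1 + x2·y1·z6·z3·y5 − x2·y1·z6·z5·y3 − x6·y2·z5·z1·y3 + x2·y6·z5·z1·y3 − z1·y2·z6·x3·y5 + z1·y2·z6·x5·y3 + z6·y2·z5·x3·y1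 − z2·y6·z5·x3·y1 = 0. (Hence this polynomial belongs to the ideal I_{C_M} of polynomials vanishing on Y_{C_M}.) -/
/-- If the span of the columns indexed by three indices has dimension less than three,
then the determinant formed by these columns vanishes. -/
theorem det_columns_eq_zero (M : Matrix (Fin 3) (Fin 6) ℂ) (f : Fin 3 → Fin 6)
    (h : colSpanDim M (Set.range f) < 3) : (M.submatrix id f).det = 0 := by
  by_contra hdet
  have hli : LinearIndependent ℂ (M.submatrix id f).col :=
    Matrix.linearIndependent_cols_of_det_ne_zero hdet
  have hcard := finrank_span_eq_card hli
  have himage : (fun j => fun i => M i j) '' Set.range f =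
      Set.range (M.submatrix id f).col := by
    rw [← Set.range_comp]
    rfl
  rw [colSpanDim, himage, hcard] at h
  simp at h

theorem menRank_lt_three_of_line {V : Set (Fin 6)}
    (hV : V = {0, 1, 5} ∨ V = {0, 2, 4}) : menRank V < 3 := by
  unfold menRank
  split_ifs with h₁ h₂
  · omega
  · omega
  · tauto

/-- The degree-5 generator of the ideal `I_{C_M}` vanishes on `X_{C_M}`
(hence on its Zariski closure `Y_{C_M}`).  Here `x i`, `y i`, `z i` denote the
three coordinates of the `(i+1)`-st column of `M`, i.e. `x_i = M_{1,i}` etc.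
in the 1-indexed notation of the paper. -/
theorem degree_five_generator_vanishes (M : Matrix (Fin 3) (Fin 6) ℂ) (hM : M ∈ Xcm)
    (x y z : Fin 6 → ℂ)
    (hx : ∀ i, x i = M 0 i) (hy : ∀ i, y i = M 1 i) (hz : ∀ i, z i = M 2 i) :
    - x 4 * y 0 * z 2 * z 5 * y 1 + x 4 * y 0 * z 2 * z 1 * y 5
      + x 2 * y 4 * z 1 * z 0 * y 5 - x 4 * y 2 * z 1 * z 0 * y 5
      + z 0 * y 4 * z 2 * x 5 * y 1 - z 0 * y 4 * z 2 * x 1 * y 5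
      - z 2 * y 4 * z 1 * x 5 * y 0 + z 4 * y 2 * z 1 * x 5 * y 0
      + x 1 * y 0 * z 5 * z 2 * y 4 - x 1 * y 0 * z 5 * z 4 * y 2
      - x 5 * y 1 * z 4 * z 0 * y 2 + x 1 * y 5 * z 4 * z 0 * y 2
      - z 0 * y 1 * z 5 * x 2 * y 4 + z 0 * y 1 * z 5 * x 4 * y 2
      + z 5 * y 1 * z 4 * x 2 * y 0 - z 1 * y 5 * z 4 * x 2 * y 0 = 0 := by
  have h₁ : (M.submatrix id ![0, 1, 5]).det = 0 := by
    apply det_columns_eq_zero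
    rw [hM]
    apply menRank_lt_three_of_line
    left
    ext i
    simp
    tauto
  have h₂ : (M.submatrix id ![0, 2, 4]).det = 0 := by
    apply det_columns_eq_zero
    rw [hM]
    apply menRank_lt_three_of_line
    right
    ext i
    simp
    tauto
  simp only [Matrix.det_fin_three, Matrix.submatrix_apply, id, Matrix.cons_val] at h₁ h₂
  simp only [hx, hy, hz]
  linear_combination (M 1 2 * M 2 4 - M 1 4 * M 2 2) * h₁ - (M 1 1 * M 2 5 - M 1 5 * M 2 1) * h₂
end

section
/- Let M ∈ X_{C_M} and write x_i = M_{1,i}, y_i = M_{2,i}, z_i = M_{3,i} for i = 1, …, 6. Assume y_i ≠ 0 for all i, and assume x3/y3 ≠ x5/y5, z2/y2 ≠ z4/y4, and z1/y1 ≠ z6/y6. Then ((x5/y5 − x1/y1)/(x3/y3 − x5/y5)) · ((z4/y4 − z3/y3)/(z2/y2 − z4/y4)) · ((z6/y6 − z2/y2)/(z1/y1 − z6/y6)) = −1. -/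
/-- Three columns of `M` span a three-dimensional space iff their determinant is nonzero. -/
theorem colSpanDim_triple_eq_three_iff (M : Matrix (Fin 3) (Fin 6) ℂ) (i j k : Fin 6) :
    colSpanDim M {i, j, k} = 3 ↔ (M.submatrix id ![i, j, k]).det ≠ 0 := by
  rw [← isUnit_iff_ne_zero, ← Matrix.isUnit_iff_isUnit_det,
    ← Matrix.linearIndependent_cols_iff_isUnit, linearIndependent_iff_card_eq_finrank_span,
    Fintype.card_fin, eq_comm]
  have h : (fun j => fun i => M i j) '' {i, j, k} =
      Set.range (M.submatrix id ![i, j, k]).col := by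
    have : (M.submatrix id ![i, j, k]).col = (fun j => fun i => M i j) ∘ ![i, j, k] := rfl
    rw [this, Set.range_comp]
    congr 1
    simp only [Matrix.range_cons, Matrix.range_empty, Set.union_empty, Set.singleton_union]
  rw [colSpanDim, h, Set.finrank]

/-- **Menelaus' theorem** in homogeneous form: if `(1 + t) P₄ = P₀ + t P₂`,
`(1 + s) P₃ = P₂ + s P₁` and `(1 + u) P₅ = P₁ + u P₀` with `P₃, P₄, P₅` collinear and
`P₀, P₁, P₂` not collinear, all in affine coordinates `(a, c)`, then `t s u = -1`. -/
theorem menelaus_affine {K : Type*} [Field K] {a c : Fin 6 → K} {t s u : K}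
    (ht : a 4 - a 0 = t * (a 2 - a 4)) (ht' : c 4 - c 0 = t * (c 2 - c 4))
    (hs : a 3 - a 2 = s * (a 1 - a 3)) (hs' : c 3 - c 2 = s * (c 1 - c 3))
    (hu : a 5 - a 1 = u * (a 0 - a 5)) (hu' : c 5 - c 1 = u * (c 0 - c 5))
    (h345 : (a 4 - a 3) * (c 5 - c 3) = (a 5 - a 3) * (c 4 - c 3))
    (h012 : (a 1 - a 0) * (c 2 - c 0) ≠ (a 2 - a 0) * (c 1 - c 0)) :
    t * s * u = -1 := by
  have key : (1 + t * s * u) *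
      ((a 1 - a 0) * (c 2 - c 0) - (a 2 - a 0) * (c 1 - c 0)) = 0 := by
    have expand : ∀ A3 A4 A5 C3 C4 C5 : K,
        A3 = a 2 + s * a 1 → A4 = a 0 + t * a 2 → A5 = a 1 + u * a 0 →
        C3 = c 2 + s * c 1 → C4 = c 0 + t * c 2 → C5 = c 1 + u * c 0 →
        (1 + t * s * u) * ((a 1 - a 0) * (c 2 - c 0) - (a 2 - a 0) * (c 1 - c 0)) =
        (1 + s) * (A4 * C5 - A5 * C4) - (1 + t) * (A3 * C5 - A5 * C3) +
          (1 + u) * (A3 * C4 - A4 * C3) := by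
      rintro _ _ _ _ _ _ rfl rfl rfl rfl rfl rfl
      ring
    rw [expand ((1 + s) * a 3) ((1 + t) * a 4) ((1 + u) * a 5)
      ((1 + s) * c 3) ((1 + t) * c 4) ((1 + u) * c 5)
      (by linear_combination hs) (by linear_combination ht) (by linear_combination hu)
      (by linear_combination hs') (by linear_combination ht') (by linear_combination hu')]
    linear_combination (1 + s) * (1 + t) * (1 + u) * h345
  have := (mul_eq_zero.mp key).resolve_right (sub_ne_zero.mpr h012)
  linear_combination this

/-- The affine Menelaus identity in the chart where the `y`-coordinate is at infinity:
for a matrix in `X_{C_M}` whose columns `(x_i, y_i, z_i)` all have `y_i ≠ 0`, and whose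
relevant ratios are distinct, the product of the three cross ratios is `-1`.
Here `x i`, `y i`, `z i` denote the three coordinates of the `(i+1)`-st column of `M`,
i.e. `x_i = M_{1,i}` etc. in the 1-indexed notation of the paper. -/
theorem menelaus_ratio_identity (M : Matrix (Fin 3) (Fin 6) ℂ) (hM : M ∈ Xcm)
    (x y z : Fin 6 → ℂ)
    (hx : ∀ i, x i = M 0 i) (hy : ∀ i, y i = M 1 i) (hz : ∀ i, z i = M 2 i)
    (hy0 : ∀ i, y i ≠ 0)
    (h1 : x 2 / y 2 ≠ x 4 / y 4)
    (h2 : z 1 / y 1 ≠ z 3 / y 3)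
    (h3 : z 0 / y 0 ≠ z 5 / y 5) :
    ((x 4 / y 4 - x 0 / y 0) / (x 2 / y 2 - x 4 / y 4)) *
      ((z 3 / y 3 - z 2 / y 2) / (z 1 / y 1 - z 3 / y 3)) *
      ((z 5 / y 5 - z 1 / y 1) / (z 0 / y 0 - z 5 / y 5)) = -1 := by
  have hdet (i j k : Fin 6) : (M.submatrix id ![i, j, k]).det =
      -(y i * y j * y k * ((x j / y j - x i / y i) * (z k / y k - z i / y i) -
        (x k / y k - x i / y i) * (z j / y j - z i / y i))) := by
    have hi := hy0 i
    have hj := hy0 j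
    have hk := hy0 k
    rw [Matrix.det_fin_three]
    simp only [Matrix.submatrix_apply, id_eq, Matrix.cons_val, ← hx, ← hy, ← hz]
    field_simp
    ring
  have hcol (i j k : Fin 6) (h : menRank {i, j, k} = 2) :
      (x j / y j - x i / y i) * (z k / y k - z i / y i) =
        (x k / y k - x i / y i) * (z j / y j - z i / y i) := by
    have h0 : (M.submatrix id ![i, j, k]).det = 0 := by
      by_contra h0
      have := (colSpanDim_triple_eq_three_iff M i j k).mpr h0
      rw [hM, h] at this
      omega
    rw [hdet] at h0
    simpa [hy0, sub_eq_zero] using h0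
  have hcard (i j k : Fin 6) (hij : i ≠ j) (hik : i ≠ k) (hjk : j ≠ k) :
      ({i, j, k} : Set (Fin 6)).ncard = 3 :=
    Set.ncard_eq_three.mpr ⟨i, j, k, hij, hik, hjk, rfl⟩
  have h015 := hcol 0 1 5 (by simp [menRank, hcard])
  have h024 := hcol 0 2 4 (by simp [menRank, hcard])
  have h123 := hcol 1 2 3 (by simp [menRank, hcard])
  have h345 := hcol 3 4 5 (by simp [menRank, hcard])
  have hrank : menRank {0, 1, 2} = 3 := by
    have hne (a b c : Fin 6) (h : (2 : Fin 6) ∉ ({a, b, c} : Set (Fin 6)) ∨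
        (0 : Fin 6) ∉ ({a, b, c} : Set (Fin 6)) ∨ (1 : Fin 6) ∉ ({a, b, c} : Set (Fin 6))) :
        ({0, 1, 2} : Set (Fin 6)) ≠ {a, b, c} := by
      intro he
      simp [← he] at h
    simp [menRank, hcard, hne]
  have h012 := (colSpanDim_triple_eq_three_iff M 0 1 2).mp (by rw [hM, hrank])
  rw [hdet] at h012
  have h1' := sub_ne_zero.mpr h1
  have h2' := sub_ne_zero.mpr h2
  have h3' := sub_ne_zero.mpr h3
  refine menelaus_affine (a := fun i => x i / y i) (c := fun i => z i / y i)
    (div_mul_cancel₀ _ h1').symm ?_ ?_ (div_mul_cancel₀ _ h2').symm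
    ?_ (div_mul_cancel₀ _ h3').symm h345 ?_
  · rw [div_mul_eq_mul_div, eq_div_iff h1']
    linear_combination h024
  · rw [div_mul_eq_mul_div, eq_div_iff h2']
    linear_combination h123
  · rw [div_mul_eq_mul_div, eq_div_iff h3']
    linear_combination h015
  · intro h
    exact h012 (by rw [h]; ring)
end

section
/- Let s, k, n be integers with 1 ≤ s ≤ n and k ≥ s, set w = k − s, and let λ1 ≥ λ2 ≥ … ≥ λ_w ≥ 0 be integers. Then for all pairwise distinct complex numbers γ1, …, γn: Δ_{(λ1 + n − s, …, λ_w + n − s)}(γ1, …, γn) = Σ_{S} [ Δ_{(λ1, …, λ_w)}((γ_j)_{j ∈ S}) · (∏_{i ∉ S} γ_i^k) / (∏_{i ∉ S} ∏_{j ∈ S} (γ_i − γ_j)) ], where the sum runs over all s-element subsets S of {1, …, n} and the complement of S is taken inside {1, …, n}. (This is the identity expressing the composition of raising operators R^{n−1}_{k−s} ∘ … ∘ R^{s}_{k−s} applied to the Schur polynomial Δ_λ as a localization sum, since that composition sends Δ_{(λ1,…,λ_w)} to Δ_{(λ1+n−s,…,λ_w+n−s)}.) -/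
/-- The `m`-th elementary symmetric polynomial of the family `(t i)_{i ∈ s}`,
with the conventions `e_0 = 1`, `e_m = 0` for `m < 0`, and `e_m = 0` for `m > |s|`. -/
noncomputable def esymZ {ι : Type*} (s : Finset ι) (t : ι → ℂ) (m : ℤ) : ℂ :=
  if 0 ≤ m then ∑ A ∈ Finset.powersetCard m.toNat s, ∏ i ∈ A, t i else 0

/-- The Schur polynomial `Δ_μ((t i)_{i ∈ s}) = det(e_{μ_i + j - i})_{1 ≤ i,j ≤ w}`
associated with a partition `μ` with `w` parts. -/
noncomputable def schur {ι : Type*} (s : Finset ι) (t : ι → ℂ) (w : ℕ)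
    (μ : Fin w → ℕ) : ℂ :=
  Matrix.det (Matrix.of fun i j : Fin w =>
    esymZ s t ((μ i : ℤ) + (j : ℤ) - (i : ℤ)))

theorem esymZ_of_card_lt {ι : Type*} {s : Finset ι} {t : ι → ℂ} {m : ℤ}
    (h : (s.card : ℤ) < m) : esymZ s t m = 0 := by
  rw [esymZ, if_pos (by omega), Finset.powersetCard_eq_empty.2 (by omega), Finset.sum_empty]

theorem esymZ_eq_add_erase {ι : Type*} [DecidableEq ι] {s : Finset ι} (t : ι → ℂ) {i : ι}
    (hi : i ∈ s) (m : ℤ) :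
    esymZ s t (m + 1) = esymZ (s.erase i) t (m + 1) + t i * esymZ (s.erase i) t m := by
  rcases lt_trichotomy m (-1) with hm | rfl | hm
  · simp [esymZ, show ¬ 0 ≤ m by omega, show ¬ 0 ≤ m + 1 by omega]
  · simp [esymZ]
  · lift m to ℕ using by omega
    have hne : i ∉ s.erase i := Finset.notMem_erase i s
    simp only [esymZ, Int.natCast_nonneg, if_true, show (0 : ℤ) ≤ (m : ℤ) + 1 by omega,
      Int.toNat_natCast, show ((m : ℤ) + 1).toNat = m + 1 by omega]
    conv_lhs => rw [← Finset.insert_erase hi]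
    rw [Finset.powersetCard_succ_insert hne, Finset.sum_union, Finset.sum_image, Finset.mul_sum]
    · congr 1
      refine Finset.sum_congr rfl fun A hA => ?_
      rw [Finset.prod_insert fun h => hne ((Finset.mem_powersetCard.1 hA).1 h)]
    · intro A hA B hB h
      have hA' : i ∉ A := fun h => hne ((Finset.mem_powersetCard.1 hA).1 h)
      have hB' : i ∉ B := fun h => hne ((Finset.mem_powersetCard.1 hB).1 h)
      rw [← Finset.erase_insert hA', ← Finset.erase_insert hB', h]
    · rw [Finset.disjoint_left]
      intro A hA hA'
      obtain ⟨B, -, rfl⟩ := Finset.mem_image.1 hA'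
      exact hne ((Finset.mem_powersetCard.1 hA).1 (Finset.mem_insert_self i B))

/-- The divided difference of `x ^ p` at `r + 1` nodes, for `p ≤ r`. -/
theorem sum_pow_div_prod_sub {ι : Type*} [DecidableEq ι] {T : Finset ι} {γ : ι → ℂ}
    (hγ : Set.InjOn γ T) {r p : ℕ} (hT : T.card = r + 1) (hp : p ≤ r) :
    ∑ i ∈ T, γ i ^ p / ∏ j ∈ T.erase i, (γ i - γ j) = if p = r then 1 else 0 := by
  have h := Lagrange.coeff_eq_sum hγ (P := Polynomial.X ^ p)
    (by rw [Polynomial.degree_X_pow, hT]; exact_mod_cast Nat.lt_succ_of_le hp)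
  simpa [hT, Polynomial.coeff_X_pow, eq_comm] using h.symm

/-- Moments of the elementary symmetric polynomials of the deleted families. -/
theorem sum_pow_succ_mul_esymZ_erase {ι : Type*} [DecidableEq ι] (T : Finset ι) (γ : ι → ℂ)
    (p : ℕ) (m : ℤ) :
    ∑ i ∈ T, γ i ^ (p + 1) / (∏ j ∈ T.erase i, (γ i - γ j)) * esymZ (T.erase i) γ m =
      (∑ i ∈ T, γ i ^ p / ∏ j ∈ T.erase i, (γ i - γ j)) * esymZ T γ (m + 1) -
        ∑ i ∈ T, γ i ^ p / (∏ j ∈ T.erase i, (γ i - γ j)) * esymZ (T.erase i) γ (m + 1) := by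
  rw [Finset.sum_mul, ← Finset.sum_sub_distrib]
  refine Finset.sum_congr rfl fun i hi => ?_
  rw [esymZ_eq_add_erase γ hi]
  ring

/-- The low moments of the elementary symmetric polynomials of high degree vanish. -/
theorem sum_pow_mul_esymZ_erase_eq_zero {ι : Type*} [DecidableEq ι] {T : Finset ι} {γ : ι → ℂ}
    (hγ : Set.InjOn γ T) {r : ℕ} (hT : T.card = r + 1) {p : ℕ} (hp : p ≤ r) {m : ℤ}
    (hm : (r : ℤ) < m + p) :
    ∑ i ∈ T, γ i ^ p / (∏ j ∈ T.erase i, (γ i - γ j)) * esymZ (T.erase i) γ m = 0 := by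
  induction p generalizing m with
  | zero =>
    refine Finset.sum_eq_zero fun i hi => ?_
    rw [esymZ_of_card_lt (by rw [Finset.card_erase_of_mem hi]; push_cast at hm; omega), mul_zero]
  | succ p ih =>
    rw [sum_pow_succ_mul_esymZ_erase, sum_pow_div_prod_sub hγ hT (by omega), if_neg (by omega),
      ih (by omega) (by push_cast at hm; omega)]
    ring

/-- The moment of order `p + 1 + r` is, up to lower terms with coefficients independent of `m`,
an elementary symmetric polynomial of the whole family. -/
theorem exists_sum_pow_mul_esymZ_erase_eq {ι : Type*} [DecidableEq ι] {T : Finset ι} {γ : ι → ℂ}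
    (hγ : Set.InjOn γ T) {r : ℕ} (hT : T.card = r + 1) (p : ℕ) :
    ∃ c : Fin p → ℂ, ∀ m : ℤ, 0 < m + p + 1 →
      ∑ i ∈ T, γ i ^ (p + 1 + r) / (∏ j ∈ T.erase i, (γ i - γ j)) * esymZ (T.erase i) γ m =
        ∑ q, c q * esymZ T γ (m + (q + 1)) + (-1) ^ p * esymZ T γ (m + p + 1) := by
  induction p with
  | zero =>
    refine ⟨Fin.elim0, fun m hm => ?_⟩
    rw [zero_add, add_comm 1 r, sum_pow_succ_mul_esymZ_erase, sum_pow_div_prod_sub hγ hT le_rfl,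
      sum_pow_mul_esymZ_erase_eq_zero hγ hT le_rfl (by push_cast at hm; omega)]
    simp
  | succ p ih =>
    obtain ⟨c, hc⟩ := ih
    refine ⟨Fin.cons (∑ i ∈ T, γ i ^ (p + 1 + r) / ∏ j ∈ T.erase i, (γ i - γ j))
      (fun q => -c q), fun m hm => ?_⟩
    rw [show p + 1 + 1 + r = (p + 1 + r) + 1 by ring, sum_pow_succ_mul_esymZ_erase,
      hc (m + 1) (by push_cast at hm; omega), Fin.sum_univ_succ]
    simp only [Fin.cons_zero, Fin.cons_succ, Fin.val_zero, Fin.val_succ, Nat.cast_add,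
      Nat.cast_zero, Nat.cast_one, neg_mul, Finset.sum_neg_distrib, zero_add]
    rw [show m + 1 + (p : ℤ) + 1 = m + (p + 1) + 1 by ring]
    simp only [add_comm, add_left_comm]
    ring

/-- The raising operator, written as a sum over deleted points, adds one to every part. -/
theorem sum_schur_erase_mul {ι : Type*} [DecidableEq ι] {T : Finset ι} {γ : ι → ℂ}
    (hγ : Set.InjOn γ T) {r : ℕ} (hT : T.card = r + 1) (w : ℕ) (lam : Fin w → ℕ) :
    ∑ i ∈ T, γ i ^ (w + r) / (∏ j ∈ T.erase i, (γ i - γ j)) * schur (T.erase i) γ w lam =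
      schur T γ w fun i => lam i + 1 := by
  cases w with
  | zero => simp [schur, sum_pow_div_prod_sub hγ hT le_rfl]
  | succ v =>
    obtain ⟨c, hc⟩ := exists_sum_pow_mul_esymZ_erase_eq hγ hT v
    set F : Matrix (Fin (v + 1)) (Fin (v + 1)) ℂ :=
      Matrix.of fun a b => esymZ T γ ((lam a : ℤ) - a + b) with hF
    set M : Matrix (Fin (v + 1)) (Fin (v + 1)) ℂ :=
      Matrix.of fun a b => esymZ T γ ((lam a : ℤ) - a + b + 1) with hM
    have herase : ∀ i ∈ T, schur (T.erase i) γ (v + 1) lam =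
        F.cramer (fun a => esymZ (T.erase i) γ ((lam a : ℤ) - a)) 0 := by
      intro i hi
      rw [Matrix.cramer_apply, schur]
      refine Matrix.det_eq_of_forall_col_eq_smul_add_pred (fun _ => -γ i) (fun a => ?_)
        fun a b => ?_
      · simp
      · have := esymZ_eq_add_erase γ hi ((lam a : ℤ) - a + b)
        simp only [hF, Matrix.of_apply, Matrix.updateCol_apply, Fin.succ_ne_zero, if_false,
          Fin.val_succ, Fin.val_castSucc, Nat.cast_add, Nat.cast_one]
        rw [show (lam a : ℤ) + (b + 1) - a = lam a - a + b + 1 by ring,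
          show (lam a : ℤ) + b - a = lam a - a + b by ring,
          show (lam a : ℤ) - a + (b + 1) = lam a - a + b + 1 by ring, this]
        ring
    have hcol : ∑ i ∈ T, (γ i ^ (v + 1 + r) / ∏ j ∈ T.erase i, (γ i - γ j)) •
          (fun a : Fin (v + 1) => esymZ (T.erase i) γ ((lam a : ℤ) - a)) =
        ∑ q : Fin v, c q • F.col q.succ + (-1 : ℂ) ^ v • M.col (Fin.last v) := by
      ext a
      have ha := a.is_lt
      simp only [Finset.sum_apply, Pi.add_apply, Pi.smul_apply, smul_eq_mul]
      rw [hc _ (by omega)]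
      simp [hF, hM, Matrix.col_apply]
    have hlast : F.cramer (M.col (Fin.last v)) 0 = (-1) ^ v * M.det := by
      have : F.updateCol 0 (M.col (Fin.last v)) = M.submatrix id (finRotate (v + 1)).symm := by
        ext a b
        obtain ⟨b, rfl⟩ := (finRotate (v + 1)).surjective b
        induction b using Fin.lastCases with
        | last =>
          rw [Matrix.submatrix_apply, Equiv.symm_apply_apply, finRotate_last]
          simp [Matrix.col_apply]
        | cast b =>
          rw [Matrix.submatrix_apply, Equiv.symm_apply_apply, finRotate_apply,
            Fin.coeSucc_eq_succ]
          simp [hF, hM, add_assoc]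
      rw [Matrix.cramer_apply, this, Matrix.det_permute', Equiv.Perm.sign_symm, sign_finRotate]
      simp
    have hzero : ∀ q : Fin v, F.cramer (F.col q.succ) 0 = 0 := by
      intro q
      rw [Matrix.cramer_apply]
      refine Matrix.det_zero_of_column_eq (Fin.succ_ne_zero q).symm fun a => ?_
      simp [Matrix.col_apply]
    have hdet : (schur T γ (v + 1) fun i => lam i + 1) = M.det := by
      rw [schur]
      congr 1
      ext a b
      simp only [hM, Matrix.of_apply]
      congr 1
      push_cast
      ring
    calc _ = F.cramer (∑ i ∈ T, (γ i ^ (v + 1 + r) / ∏ j ∈ T.erase i, (γ i - γ j)) •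
          (fun a : Fin (v + 1) => esymZ (T.erase i) γ ((lam a : ℤ) - a))) 0 := by
          rw [map_sum, Finset.sum_apply]
          refine Finset.sum_congr rfl fun i hi => ?_
          rw [herase i hi, map_smul, Pi.smul_apply, smul_eq_mul]
      _ = M.det := by
          rw [hcol, map_add, map_sum, map_smul, Pi.add_apply, Pi.smul_apply, Finset.sum_apply,
            hlast, smul_eq_mul, ← mul_assoc, ← mul_pow]
          simp [hzero]
      _ = _ := hdet.symm

/-- The localization formula for the `m`-fold raising operator, over a finite index set. -/
theorem schur_add_eq_sum_powersetCard {ι : Type*} [DecidableEq ι] {γ : ι → ℂ} (s w : ℕ)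
    (lam : Fin w → ℕ) (m : ℕ) {T : Finset ι} (hγ : Set.InjOn γ T) (hT : T.card = s + m) :
    (schur T γ w fun i => lam i + m) = ∑ S ∈ T.powersetCard s,
      schur S γ w lam * (∏ i ∈ T \ S, γ i ^ (w + s)) /
        ∏ i ∈ T \ S, ∏ j ∈ S, (γ i - γ j) := by
  induction m generalizing T with
  | zero =>
    obtain rfl : T.card = s := hT
    simp
  | succ m ih =>
    simp only [← add_assoc _ m 1]
    rw [← sum_schur_erase_mul (lam := fun i => lam i + m) hγ (r := s + m) hT w]
    have hstep : ∀ i ∈ T, γ i ^ (w + (s + m)) / (∏ j ∈ T.erase i, (γ i - γ j)) *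
          (schur (T.erase i) γ w fun i => lam i + m) =
        ∑ S ∈ (T.erase i).powersetCard s, (schur S γ w lam * (∏ i ∈ T \ S, γ i ^ (w + s)) /
          ∏ i ∈ T \ S, ∏ j ∈ S, (γ i - γ j)) *
            (γ i ^ m / ∏ j ∈ (T \ S).erase i, (γ i - γ j)) := by
      intro i hi
      rw [ih (hγ.mono (by simp)) (by rw [Finset.card_erase_of_mem hi, hT]; rfl), Finset.mul_sum]
      refine Finset.sum_congr rfl fun S hS => ?_
      have hST := (Finset.mem_powersetCard.1 hS).1
      have hiS : i ∉ S := fun h => Finset.notMem_erase i T (hST h)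
      have hU : i ∈ T \ S := Finset.mem_sdiff.2 ⟨hi, hiS⟩
      rw [Finset.erase_sdiff_comm, ← Finset.mul_prod_erase _ _ hU, ← Finset.mul_prod_erase _ _ hU]
      have hTi : T.erase i = (T \ S).erase i ∪ S := by
        ext j
        have := @hST j
        simp only [Finset.mem_erase, Finset.mem_union, Finset.mem_sdiff] at this ⊢
        tauto
      have hdis : Disjoint ((T \ S).erase i) S :=
        Finset.sdiff_disjoint.mono_left (Finset.erase_subset _ _)
      rw [hTi, Finset.prod_union hdis, div_mul_div_comm, div_mul_div_comm]
      congr 1 <;> ring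
    rw [Finset.sum_congr rfl hstep, Finset.sum_comm' (t' := T.powersetCard s)
      (s' := fun S => T \ S)]
    · refine Finset.sum_congr rfl fun S hS => ?_
      rw [Finset.mem_powersetCard] at hS
      rw [← Finset.mul_sum, sum_pow_div_prod_sub (hγ.mono (by simp)) (r := m) _ le_rfl,
        if_pos rfl, mul_one]
      rw [Finset.card_sdiff_of_subset hS.1]
      omega
    · intro i S
      simp only [Finset.mem_powersetCard, Finset.mem_sdiff, Finset.subset_erase]
      tauto

/-- The localization-sum identity for the composition of raising operators
`R^{n-1}_{k-s} ∘ … ∘ R^{s}_{k-s}` applied to the Schur polynomial `Δ_λ`: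
that composition sends `Δ_{(λ₁,…,λ_w)}` to `Δ_{(λ₁+n-s,…,λ_w+n-s)}`, and the
latter equals the localization sum over all `s`-element subsets `S` of `{1,…,n}`. -/
theorem raising_eq_localization_sum (s k n : ℕ) (hs : 1 ≤ s) (hsn : s ≤ n) (hk : s ≤ k)
    (w : ℕ) (hw : w = k - s) (lam : Fin w → ℕ) (hlam : Antitone lam)
    (γ : Fin n → ℂ) (hγ : Function.Injective γ) :
    schur Finset.univ γ w (fun i => lam i + (n - s)) =
      ∑ S ∈ Finset.powersetCard s (Finset.univ : Finset (Fin n)),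
        schur S γ w lam * (∏ i ∈ Sᶜ, γ i ^ k) /
          (∏ i ∈ Sᶜ, ∏ j ∈ S, (γ i - γ j)) := by
  rw [schur_add_eq_sum_powersetCard s w lam (n - s) hγ.injOn (by simp; omega),
    show w + s = k by omega]
  simp only [Finset.compl_eq_univ_sdiff]
end

section
/- Give the polynomial ring ℚ[c1, c2, c3, d1, …, d6] the grading in which c_i has degree i and each d_j has degree 1. For an unordered triple {a, b, c} ⊂ {1, …, 6}, let φ_{a|b|c} : ℚ[c1, c2, c3, d1, …, d6] → ℚ[α, β, γ, δ, η, θ] be the ℚ-algebra homomorphism with c1 ↦ α + β + γ, c2 ↦ αβ + αγ + βγ, c3 ↦ αβγ, d_a ↦ α, d_b ↦ β, d_c ↦ γ, and the remaining three variables d_j (taken in increasing order of the index j) mapped to δ, η, θ respectively. Then the ℚ-vector space of homogeneous degree-4 polynomials lying in the intersection of the kernels of the four maps φ_{1|2|6}, φ_{1|3|5}, φ_{2|3|4}, φ_{4|5|6} has dimension 2. -/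
open MvPolynomial

/-- The grading weights on `ℚ[c₁,c₂,c₃,d₁,…,d₆]` (variables `0,1,2` are `c₁,c₂,c₃`
of degrees `1,2,3`; variables `3,…,8` are `d₁,…,d₆` of degree `1`). -/
def wt : Fin 9 → ℕ := ![1, 2, 3, 1, 1, 1, 1, 1, 1]

/-- The restriction homomorphism `φ_{1|2|6}` to `ℚ[α,β,γ,δ,η,θ]`:
`c₁ ↦ α+β+γ`, `c₂ ↦ αβ+αγ+βγ`, `c₃ ↦ αβγ`, `d₁ ↦ α`, `d₂ ↦ β`, `d₆ ↦ γ`,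
and `d₃, d₄, d₅ ↦ δ, η, θ`. -/
noncomputable def φ126 : MvPolynomial (Fin 9) ℚ →ₐ[ℚ] MvPolynomial (Fin 6) ℚ :=
  aeval ![X 0 + X 1 + X 2, X 0 * X 1 + X 0 * X 2 + X 1 * X 2, X 0 * X 1 * X 2,
    X 0, X 1, X 3, X 4, X 5, X 2]

/-- The restriction homomorphism `φ_{1|3|5}`: `d₁ ↦ α`, `d₃ ↦ β`, `d₅ ↦ γ`,
and `d₂, d₄, d₆ ↦ δ, η, θ`. -/
noncomputable def φ135 : MvPolynomial (Fin 9) ℚ →ₐ[ℚ] MvPolynomial (Fin 6) ℚ :=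
  aeval ![X 0 + X 1 + X 2, X 0 * X 1 + X 0 * X 2 + X 1 * X 2, X 0 * X 1 * X 2,
    X 0, X 3, X 1, X 4, X 2, X 5]

/-- The restriction homomorphism `φ_{2|3|4}`: `d₂ ↦ α`, `d₃ ↦ β`, `d₄ ↦ γ`,
and `d₁, d₅, d₆ ↦ δ, η, θ`. -/
noncomputable def φ234 : MvPolynomial (Fin 9) ℚ →ₐ[ℚ] MvPolynomial (Fin 6) ℚ :=
  aeval ![X 0 + X 1 + X 2, X 0 * X 1 + X 0 * X 2 + X 1 * X 2, X 0 * X 1 * X 2,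
    X 3, X 0, X 1, X 2, X 4, X 5]

/-- The restriction homomorphism `φ_{4|5|6}`: `d₄ ↦ α`, `d₅ ↦ β`, `d₆ ↦ γ`,
and `d₁, d₂, d₃ ↦ δ, η, θ`. -/
noncomputable def φ456 : MvPolynomial (Fin 9) ℚ →ₐ[ℚ] MvPolynomial (Fin 6) ℚ :=
  aeval ![X 0 + X 1 + X 2, X 0 * X 1 + X 0 * X 2 + X 1 * X 2, X 0 * X 1 * X 2,
    X 3, X 4, X 5, X 0, X 1, X 2]

lemma MvPolynomial.IsWeightedHomogeneous.exists_eval_cons_eq_sum {n : ℕ} {w : Fin (n + 1) → ℕ}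
    {p : MvPolynomial (Fin (n + 1)) ℚ} {N : ℕ} (hp : IsWeightedHomogeneous w p N)
    (m : ℕ) (hm : N < w 0 * m) :
    ∃ A : ℕ → MvPolynomial (Fin n) ℚ,
      (∀ i k, w 0 * i + k = N → IsWeightedHomogeneous (Fin.tail w) (A i) k) ∧
      ∀ (x : ℚ) (y : Fin n → ℚ), eval (Fin.cons x y : Fin (n + 1) → ℚ) p =
        ∑ i ∈ Finset.range m, eval y (A i) * x ^ i := by
  have hw (i : ℕ) (s : Fin n →₀ ℕ) :
      Finsupp.weight w (s.cons i) = w 0 * i + Finsupp.weight (Fin.tail w) s := by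
    simp [Finsupp.weight_eq_sum, Fin.sum_univ_succ, Fin.tail, mul_comm]
  refine ⟨fun i => (finSuccEquiv ℚ n p).coeff i, fun i k hk s hs => ?_, fun x y => ?_⟩
  · rw [finSuccEquiv_coeff_coeff] at hs
    have := hp hs
    rw [hw] at this
    omega
  · have hdeg : (finSuccEquiv ℚ n p).natDegree < m := by
      have hm0 : 0 < m := Nat.pos_of_ne_zero (by rintro rfl; simp at hm)
      by_contra! h
      have hne : finSuccEquiv ℚ n p ≠ 0 := by
        intro h0
        simp [h0] at h
        omega
      obtain ⟨s, hs⟩ := MvPolynomial.ne_zero_iff.mp (Polynomial.leadingCoeff_ne_zero.mpr hne)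
      rw [Polynomial.leadingCoeff, finSuccEquiv_coeff_coeff] at hs
      have := hp hs
      rw [hw] at this
      nlinarith
    rw [eval_eq_eval_mv_eval', Polynomial.eval_map, Polynomial.eval₂_eq_sum_range' _ hdeg]

lemma MvPolynomial.IsHomogeneous.exists_eval_eq_linear {n : ℕ} {p : MvPolynomial (Fin n) ℚ}
    (hp : p.IsHomogeneous 1) :
    ∃ a : Fin n → ℚ, ∀ d : Fin n → ℚ, eval d p = ∑ i, a i * d i := by
  have h : p ∈ Submodule.span ℚ (Set.range (X : Fin n → MvPolynomial (Fin n) ℚ)) := by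
    rwa [← homogeneousSubmodule_one_eq_span_X, mem_homogeneousSubmodule]
  obtain ⟨a, rfl⟩ := (Submodule.mem_span_range_iff_exists_fun ℚ).mp h
  exact ⟨a, fun d => by simp [smul_eval]⟩

lemma MvPolynomial.IsHomogeneous.exists_eval_eq_quadratic {n : ℕ} {p : MvPolynomial (Fin n) ℚ}
    (hp : p.IsHomogeneous 2) :
    ∃ q : Fin n → Fin n → ℚ, (∀ i j, q i j = q j i) ∧
      ∀ d : Fin n → ℚ, eval d p = ∑ i, ∑ j, q i j * d i * d j := by
  have h : p ∈ homogeneousSubmodule (Fin n) ℚ 1 * homogeneousSubmodule (Fin n) ℚ 1 := by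
    rwa [← pow_two, homogeneousSubmodule_one_pow, mem_homogeneousSubmodule]
  induction h using Submodule.mul_induction_on' with
  | mem_mul_mem f hf g hg =>
    obtain ⟨a, ha⟩ := exists_eval_eq_linear ((mem_homogeneousSubmodule 1 f).mp hf)
    obtain ⟨b, hb⟩ := exists_eval_eq_linear ((mem_homogeneousSubmodule 1 g).mp hg)
    refine ⟨fun i j => (a i * b j + a j * b i) / 2, fun i j => by ring, fun d => ?_⟩
    have h1 : eval d (f * g) = ∑ i, ∑ j, (a i * d i) * (b j * d j) := by
      rw [eval_mul, ha, hb, Finset.sum_mul_sum]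
    have h2 : eval d (f * g) = ∑ i, ∑ j, (a j * d j) * (b i * d i) := by
      rw [h1, Finset.sum_comm]
    have h3 : eval d (f * g) = (eval d (f * g) + eval d (f * g)) / 2 := by ring
    rw [h3]
    nth_rewrite 1 [h1]
    rw [h2]
    simp only [← Finset.sum_add_distrib, Finset.sum_div]
    exact Finset.sum_congr rfl fun i _ => Finset.sum_congr rfl fun j _ => by ring
  | add f hf g hg ihf ihg =>
    have hom {r : MvPolynomial (Fin n) ℚ}
        (hr : r ∈ homogeneousSubmodule (Fin n) ℚ 1 * homogeneousSubmodule (Fin n) ℚ 1) :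
        r.IsHomogeneous 2 := by
      rwa [← pow_two, homogeneousSubmodule_one_pow, mem_homogeneousSubmodule] at hr
    obtain ⟨q, hq, hqf⟩ := ihf (hom hf)
    obtain ⟨r, hr, hrg⟩ := ihg (hom hg)
    refine ⟨fun i j => q i j + r i j, fun i j => by simp only [hq i j, hr i j], fun d => ?_⟩
    simp [hqf, hrg, add_mul, Finset.sum_add_distrib]

/-- A quartic in `c₁, c₂, c₃, d₁, …, d₆`, organised by its monomials in the `cᵢ`. -/
noncomputable def quarticForm (l₀ l₁ l₂ l₃ : ℚ) (a b : Fin 6 → ℚ) (q : Fin 6 → Fin 6 → ℚ)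
    (A : Fin 4 → MvPolynomial (Fin 6) ℚ) (x y z : ℚ) (d : Fin 6 → ℚ) : ℚ :=
  l₀ * x ^ 4 + l₁ * x ^ 2 * y + l₂ * y ^ 2 + l₃ * x * z + eval d (A 3) * x ^ 3 +
    x * y * (∑ i, a i * d i) + z * (∑ i, b i * d i) + y * (∑ i, ∑ j, q i j * d i * d j) +
    eval d (A 2) * x ^ 2 + eval d (A 1) * x + eval d (A 0)

lemma exists_eq_quarticForm {p : MvPolynomial (Fin 9) ℚ} (hp : IsWeightedHomogeneous wt p 4) :
    ∃ (l₀ l₁ l₂ l₃ : ℚ) (a b : Fin 6 → ℚ) (q : Fin 6 → Fin 6 → ℚ)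
      (A : Fin 4 → MvPolynomial (Fin 6) ℚ),
      (∀ i j, q i j = q j i) ∧ (∀ k, eval 0 (A k) = 0) ∧ ∀ x y z d,
        eval (Fin.cons x (Fin.cons y (Fin.cons z d : Fin 7 → ℚ) : Fin 8 → ℚ) : Fin 9 → ℚ) p =
          quarticForm l₀ l₁ l₂ l₃ a b q A x y z d := by
  have htail : Fin.tail (Fin.tail (Fin.tail wt)) = (1 : Fin 6 → ℕ) := by
    ext i; fin_cases i <;> rfl
  have h1 (B : MvPolynomial (Fin 8) ℚ) (N : ℕ) (hB : IsWeightedHomogeneous (Fin.tail wt) B N)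
      (m : ℕ) (hm : N < 2 * m) := hB.exists_eval_cons_eq_sum m hm
  have h2 (B : MvPolynomial (Fin 7) ℚ) (N : ℕ)
      (hB : IsWeightedHomogeneous (Fin.tail (Fin.tail wt)) B N)
      (m : ℕ) (hm : N < 3 * m) := hB.exists_eval_cons_eq_sum m hm
  simp only [htail] at h2
  obtain ⟨P, hP, hPe⟩ := hp.exists_eval_cons_eq_sum 5 (by decide)
  have hP' (i k : ℕ) (h : i + k = 4) : IsWeightedHomogeneous (Fin.tail wt) (P i) k :=
    hP i k (by simpa [wt] using h)
  obtain ⟨B0, hB0, hB0e⟩ := h1 _ 4 (hP' 0 4 rfl) 3 (by norm_num)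
  obtain ⟨B1, hB1, hB1e⟩ := h1 _ 3 (hP' 1 3 rfl) 2 (by norm_num)
  obtain ⟨B2, hB2, hB2e⟩ := h1 _ 2 (hP' 2 2 rfl) 2 (by norm_num)
  obtain ⟨B3, hB3, hB3e⟩ := h1 _ 1 (hP' 3 1 rfl) 1 (by norm_num)
  obtain ⟨B4, hB4, hB4e⟩ := h1 _ 0 (hP' 4 0 rfl) 1 (by norm_num)
  obtain ⟨C00, hC00, hC00e⟩ := h2 _ 4 (hB0 0 4 rfl) 2 (by norm_num)
  obtain ⟨C01, hC01, hC01e⟩ := h2 _ 2 (hB0 1 2 rfl) 1 (by norm_num)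
  obtain ⟨C02, hC02, hC02e⟩ := h2 _ 0 (hB0 2 0 rfl) 1 (by norm_num)
  obtain ⟨C10, hC10, hC10e⟩ := h2 _ 3 (hB1 0 3 rfl) 2 (by norm_num)
  obtain ⟨C11, hC11, hC11e⟩ := h2 _ 1 (hB1 1 1 rfl) 1 (by norm_num)
  obtain ⟨C20, hC20, hC20e⟩ := h2 _ 2 (hB2 0 2 rfl) 1 (by norm_num)
  obtain ⟨C21, hC21, hC21e⟩ := h2 _ 0 (hB2 1 0 rfl) 1 (by norm_num)
  obtain ⟨C30, hC30, hC30e⟩ := h2 _ 1 (hB3 0 1 rfl) 1 (by norm_num)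
  obtain ⟨C40, hC40, hC40e⟩ := h2 _ 0 (hB4 0 0 rfl) 1 (by norm_num)
  have hconst {r : MvPolynomial (Fin 6) ℚ} (hr : IsWeightedHomogeneous (1 : Fin 6 → ℕ) r 0)
      (d : Fin 6 → ℚ) : eval d r = r.coeff 0 := by
    rw [(totalDegree_eq_zero_iff_eq_C).mp ((totalDegree_zero_iff_isHomogeneous _).mpr hr)]
    simp
  have hzero {r : MvPolynomial (Fin 6) ℚ} {k : ℕ}
      (hr : IsWeightedHomogeneous (1 : Fin 6 → ℕ) r (k + 1)) : eval 0 r = 0 := by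
    rw [eval_zero, constantCoeff_eq]
    exact IsHomogeneous.coeff_eq_zero hr (by simp)
  obtain ⟨a, ha⟩ := IsHomogeneous.exists_eval_eq_linear (hC11 0 1 rfl)
  obtain ⟨b, hb⟩ := IsHomogeneous.exists_eval_eq_linear (hC00 1 1 rfl)
  obtain ⟨q, hq, hqe⟩ := IsHomogeneous.exists_eval_eq_quadratic (hC01 0 2 rfl)
  refine ⟨(C40 0).coeff 0, (C21 0).coeff 0, (C02 0).coeff 0, (C10 1).coeff 0, a, b, q,
    ![C00 0, C10 0, C20 0, C30 0], hq, fun k => ?_, fun x y z d => ?_⟩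
  · fin_cases k
    · exact hzero (hC00 0 4 rfl)
    · exact hzero (hC10 0 3 rfl)
    · exact hzero (hC20 0 2 rfl)
    · exact hzero (hC30 0 1 rfl)
  · simp only [hPe, hB0e, hB1e, hB2e, hB3e, hB4e, hC00e, hC01e, hC02e, hC10e, hC11e, hC20e, hC21e,
      hC30e, hC40e, Finset.sum_range_succ, Finset.sum_range_zero, quarticForm,
      hconst (hC40 0 0 rfl), hconst (hC21 0 0 rfl), hconst (hC02 0 0 rfl), hconst (hC10 1 0 rfl),
      ha, hb, hqe]
    simp only [Matrix.cons_val]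
    ring

set_option maxHeartbeats 1000000 in
lemma coeff_relations_of_hyperplane {l₁ l₃ : ℚ} {a b : Fin 6 → ℚ} {q : Fin 6 → Fin 6 → ℚ}
    (hq : ∀ i j, q i j = q j i)
    (h : ∀ d : Fin 6 → ℚ, d 1 + d 5 = d 2 + d 4 → d 1 * d 5 ≠ d 2 * d 4 →
      l₁ * (d 0 + d 1 + d 5) ^ 2 + l₃ * (d 0 + d 1 + d 5) * d 0 +
        (d 0 + d 1 + d 5) * (∑ i, a i * d i) + d 0 * (∑ i, b i * d i) +
        ∑ i, ∑ j, q i j * d i * d j = 0) :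
    q 3 3 = 0 ∧ q 1 1 + q 5 5 = 2 * q 1 5 ∧ q 2 2 + q 4 4 = 2 * q 2 4 ∧
      2 * q 3 1 + 2 * q 3 4 + a 3 = 0 ∧ q 1 1 + q 4 4 + 2 * q 1 4 + a 1 + a 4 + l₁ = 0 ∧
      2 * q 0 3 + a 3 + b 3 = 0 ∧ q 0 0 + a 0 + b 0 + l₁ + l₃ = 0 ∧
      2 * q 0 1 + 2 * q 0 4 + a 0 + a 1 + a 4 + b 1 + b 4 + 2 * l₁ + l₃ = 0 := by
  have H (x u v w y : ℚ) (hne : (w - u) * (w - v) ≠ 0) := h ![x, u, w, y, u + v - w, v]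
    (by simp) (by simpa [sub_ne_zero] using fun e => hne (by linarith))
  simp only [Fin.sum_univ_six, Matrix.cons_val] at H
  simp only [hq 1 0, hq 2 0, hq 3 0, hq 4 0, hq 5 0, hq 2 1, hq 3 1, hq 4 1, hq 5 1, hq 3 2,
    hq 4 2, hq 5 2, hq 4 3, hq 5 3, hq 5 4] at H ⊢
  have e1 := H 0 1 (-1) 0 0 (by norm_num)
  have e2 := H 0 1 (-1) 0 1 (by norm_num)
  have e3 := H 0 1 (-1) 0 (-1) (by norm_num)
  have e4 := H 1 1 (-1) 0 0 (by norm_num)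
  have e5 := H (-1) 1 (-1) 0 0 (by norm_num)
  have e6 := H 1 1 (-1) 0 1 (by norm_num)
  have e7 := H 0 1 1 0 0 (by norm_num)
  have e8 := H 0 1 1 0 1 (by norm_num)
  have e9 := H 1 1 1 0 0 (by norm_num)
  have e10 := H 0 0 0 1 0 (by norm_num)
  have e11 := H 0 2 1 0 0 (by norm_num)
  refine ⟨?_, ?_, ?_, ?_, ?_, ?_, ?_, ?_⟩ <;> linarith

/-- A quartic form vanishes along the section `(c₁, c₂, c₃) = (e₁, e₂, e₃)(dᵢ, dⱼ, dₖ)`. -/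
def VanishesOn (F : ℚ → ℚ → ℚ → (Fin 6 → ℚ) → ℚ) (i j k : Fin 6) : Prop :=
  ∀ d : Fin 6 → ℚ,
    F (d i + d j + d k) (d i * d j + d i * d k + d j * d k) (d i * d j * d k) d = 0

lemma VanishesOn.swap_left {F : ℚ → ℚ → ℚ → (Fin 6 → ℚ) → ℚ} {i j k : Fin 6}
    (h : VanishesOn F i j k) : VanishesOn F j i k := fun d => by
  convert h d using 2 <;> ring

lemma VanishesOn.swap_right {F : ℚ → ℚ → ℚ → (Fin 6 → ℚ) → ℚ} {i j k : Fin 6}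
    (h : VanishesOn F i j k) : VanishesOn F i k j := fun d => by
  convert h d using 2 <;> ring

lemma VanishesOn.rotate {F : ℚ → ℚ → ℚ → (Fin 6 → ℚ) → ℚ} {i j k : Fin 6}
    (h : VanishesOn F i j k) : VanishesOn F k i j := h.swap_right.swap_left

lemma VanishesOn.hyperplane {l₀ l₁ l₃ : ℚ} {a b : Fin 6 → ℚ} {q : Fin 6 → Fin 6 → ℚ}
    {A : Fin 4 → MvPolynomial (Fin 6) ℚ} {r u v w z : Fin 6}
    (h₁ : VanishesOn (quarticForm l₀ l₁ 0 l₃ a b q A) r u v)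
    (h₂ : VanishesOn (quarticForm l₀ l₁ 0 l₃ a b q A) r w z)
    (d : Fin 6 → ℚ) (hs : d u + d v = d w + d z) (hne : d u * d v ≠ d w * d z) :
    l₁ * (d r + d u + d v) ^ 2 + l₃ * (d r + d u + d v) * d r +
      (d r + d u + d v) * (∑ i, a i * d i) + d r * (∑ i, b i * d i) +
      ∑ i, ∑ j, q i j * d i * d j = 0 := by
  have e₁ := h₁ d
  have e₂ := h₂ d
  rw [show d r + d w + d z = d r + d u + d v by linarith] at e₂
  refine mul_left_cancel₀ (sub_ne_zero.mpr hne) ?_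
  simp only [quarticForm] at e₁ e₂
  linear_combination e₁ - e₂ - d r * (l₁ * (d r + d u + d v) ^ 2 +
    (d r + d u + d v) * (∑ i, a i * d i) + ∑ i, ∑ j, q i j * d i * d j) * hs

lemma VanishesOn.coeff_relations {l₀ l₁ l₃ : ℚ} {a b : Fin 6 → ℚ} {q : Fin 6 → Fin 6 → ℚ}
    (hq : ∀ i j, q i j = q j i) {A : Fin 4 → MvPolynomial (Fin 6) ℚ} {r u w y z v : Fin 6}
    (hσ : Function.Bijective ![r, u, w, y, z, v])
    (h₁ : VanishesOn (quarticForm l₀ l₁ 0 l₃ a b q A) r u v)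
    (h₂ : VanishesOn (quarticForm l₀ l₁ 0 l₃ a b q A) r w z) :
    q y y = 0 ∧ q u u + q v v = 2 * q u v ∧ q w w + q z z = 2 * q w z ∧
      2 * q y u + 2 * q y z + a y = 0 ∧ q u u + q z z + 2 * q u z + a u + a z + l₁ = 0 ∧
      2 * q r y + a y + b y = 0 ∧ q r r + a r + b r + l₁ + l₃ = 0 ∧
      2 * q r u + 2 * q r z + a r + a u + a z + b u + b z + 2 * l₁ + l₃ = 0 := by
  set σ : Fin 6 ≃ Fin 6 := Equiv.ofBijective _ hσ with hσd
  have hσ' (i : Fin 6) : σ i = ![r, u, w, y, z, v] i := rfl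
  refine coeff_relations_of_hyperplane (a := a ∘ σ) (b := b ∘ σ) (q := fun i j => q (σ i) (σ j))
    (fun i j => hq _ _) fun d hs hne => ?_
  have hr (i j : Fin 6) (h : σ i = j) : d (σ.symm j) = d i := by simp [← h]
  have key := h₁.hyperplane h₂ (d ∘ σ.symm)
  simp only [Function.comp_apply, hr 0 r rfl, hr 1 u rfl, hr 2 w rfl, hr 4 z rfl, hr 5 v rfl] at key
  have hsum (f : Fin 6 → ℚ) : ∑ i, f (σ i) * d i = ∑ i, f i * d (σ.symm i) := by
    rw [← σ.sum_comp fun i => f i * d (σ.symm i)]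
    simp only [Equiv.symm_apply_apply]
  have hsum₂ : ∑ i, ∑ j, q (σ i) (σ j) * d i * d j =
      ∑ i, ∑ j, q i j * d (σ.symm i) * d (σ.symm j) := by
    rw [← σ.sum_comp fun i => ∑ j, q i j * d (σ.symm i) * d (σ.symm j)]
    refine Finset.sum_congr rfl fun i _ => ?_
    rw [← σ.sum_comp fun j => q (σ i) j * d (σ.symm (σ i)) * d (σ.symm j)]
    simp only [Equiv.symm_apply_apply]
  simp only [Function.comp_apply]
  rw [hsum a, hsum b, hsum₂]
  exact key hs hne

lemma lower_coeffs_eq_zero {l₀ l₁ l₃ : ℚ} {a b : Fin 6 → ℚ} {q : Fin 6 → Fin 6 → ℚ}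
    (hq : ∀ i j, q i j = q j i) {A : Fin 4 → MvPolynomial (Fin 6) ℚ}
    (h126 : VanishesOn (quarticForm l₀ l₁ 0 l₃ a b q A) 0 1 5)
    (h135 : VanishesOn (quarticForm l₀ l₁ 0 l₃ a b q A) 0 2 4)
    (h234 : VanishesOn (quarticForm l₀ l₁ 0 l₃ a b q A) 1 2 3)
    (h456 : VanishesOn (quarticForm l₀ l₁ 0 l₃ a b q A) 3 4 5) :
    l₁ = 0 ∧ l₃ = 0 ∧ a = 0 ∧ b = 0 ∧ q = 0 := by
  have R₁ := VanishesOn.coeff_relations hq (r := 0) (u := 1) (w := 2) (y := 3) (z := 4) (v := 5)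
    (by decide) h126 h135
  have R₂ := VanishesOn.coeff_relations hq (r := 1) (u := 0) (w := 2) (y := 4) (z := 3) (v := 5)
    (by decide) h126.swap_left h234
  have R₃ := VanishesOn.coeff_relations hq (r := 2) (u := 0) (w := 1) (y := 5) (z := 3) (v := 4)
    (by decide) h135.swap_left h234.swap_left
  have R₄ := VanishesOn.coeff_relations hq (r := 3) (u := 1) (w := 5) (y := 0) (z := 4) (v := 2)
    (by decide) h234.rotate h456.swap_right
  have R₅ := VanishesOn.coeff_relations hq (r := 4) (u := 0) (w := 5) (y := 1) (z := 3) (v := 2)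
    (by decide) h135.rotate h456.rotate.rotate
  have R₆ := VanishesOn.coeff_relations hq (r := 5) (u := 0) (w := 4) (y := 2) (z := 3) (v := 1)
    (by decide) h126.rotate h456.rotate.swap_right
  simp only [hq 1 0, hq 2 0, hq 3 0, hq 4 0, hq 5 0, hq 3 1, hq 4 1, hq 5 2, hq 4 3, hq 5 3,
    hq 5 4] at R₁ R₂ R₃ R₄ R₅ R₆
  obtain ⟨d3, q15, q24, a3, s14, b3, t0, m0⟩ := R₁
  obtain ⟨d4, q05, q23, a4, s03, b4, t1, m1⟩ := R₂
  obtain ⟨d5, q04, q13, a5, -, b5, t2, m2⟩ := R₃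
  obtain ⟨d0, q12, q45, a0, -, b0, t3, m3⟩ := R₄
  obtain ⟨d1, q02, q35, a1, -, b1, t4, m4⟩ := R₅
  obtain ⟨d2, q01, q34, a2, -, b2, t5, m5⟩ := R₆
  rw [d0, d1] at q01
  rw [d0, d2] at q02
  rw [d0, d4] at q04
  rw [d0, d5] at q05
  rw [d1, d2] at q12
  rw [d1, d3] at q13
  rw [d1, d5] at q15
  rw [d2, d3] at q23
  rw [d2, d4] at q24
  rw [d3, d4] at q34
  rw [d3, d5] at q35
  rw [d4, d5] at q45
  have hl₁ : l₁ = 0 := by linarith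
  have hl₃ : l₃ = 0 := by linarith
  refine ⟨hl₁, hl₃, ?_, ?_, ?_⟩
  · ext i; fin_cases i <;> simp only [Fin.reduceFinMk, Fin.mk_one, Fin.zero_eta, Pi.zero_apply] <;>
      linarith
  · ext i; fin_cases i <;> simp only [Fin.reduceFinMk, Fin.mk_one, Fin.zero_eta, Pi.zero_apply] <;>
      linarith
  · ext i j
    wlog hij : i ≤ j generalizing i j
    · rw [hq]
      exact this j i (le_of_not_ge hij)
    fin_cases i <;> fin_cases j <;>
      simp only [Fin.reduceFinMk, Fin.mk_one, Fin.zero_eta, Pi.zero_apply] <;>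
      first | linarith | exact absurd hij (by decide)

lemma cubic_coeffs_eq_zero {K : Type*} [Field K] {a₀ a₁ a₂ a₃ x y z t : K}
    (hx : a₃ * x ^ 3 + a₂ * x ^ 2 + a₁ * x + a₀ = 0)
    (hy : a₃ * y ^ 3 + a₂ * y ^ 2 + a₁ * y + a₀ = 0)
    (hz : a₃ * z ^ 3 + a₂ * z ^ 2 + a₁ * z + a₀ = 0)
    (ht : a₃ * t ^ 3 + a₂ * t ^ 2 + a₁ * t + a₀ = 0)
    (hne : (x - y) * (x - z) * (x - t) * (y - z) * (y - t) * (z - t) ≠ 0) :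
    a₀ = 0 ∧ a₁ = 0 ∧ a₂ = 0 ∧ a₃ = 0 := by
  simp only [ne_eq, mul_eq_zero, not_or] at hne
  obtain ⟨⟨⟨⟨⟨hxy, hxz⟩, hxt⟩, hyz⟩, hyt⟩, hzt⟩ := hne
  have dxy : a₃ * (x ^ 2 + x * y + y ^ 2) + a₂ * (x + y) + a₁ = 0 :=
    mul_left_cancel₀ hxy (by linear_combination hx - hy)
  have dxz : a₃ * (x ^ 2 + x * z + z ^ 2) + a₂ * (x + z) + a₁ = 0 :=
    mul_left_cancel₀ hxz (by linear_combination hx - hz)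
  have dxt : a₃ * (x ^ 2 + x * t + t ^ 2) + a₂ * (x + t) + a₁ = 0 :=
    mul_left_cancel₀ hxt (by linear_combination hx - ht)
  have dyz : a₃ * (x + y + z) + a₂ = 0 :=
    mul_left_cancel₀ hyz (by linear_combination dxy - dxz)
  have dyt : a₃ * (x + y + t) + a₂ = 0 :=
    mul_left_cancel₀ hyt (by linear_combination dxy - dxt)
  have h₃ : a₃ = 0 := mul_left_cancel₀ hzt (by linear_combination dyz - dyt)
  subst h₃
  have h₂ : a₂ = 0 := by linear_combination dyz
  subst h₂
  have h₁ : a₁ = 0 := by linear_combination dxy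
  subst h₁
  exact ⟨by linear_combination hx, rfl, rfl, rfl⟩

lemma polynomial_coeffs_eq_zero {A : Fin 4 → MvPolynomial (Fin 6) ℚ}
    (h126 : VanishesOn (quarticForm 0 0 0 0 0 0 0 A) 0 1 5)
    (h135 : VanishesOn (quarticForm 0 0 0 0 0 0 0 A) 0 2 4)
    (h234 : VanishesOn (quarticForm 0 0 0 0 0 0 0 A) 1 2 3)
    (h456 : VanishesOn (quarticForm 0 0 0 0 0 0 0 A) 3 4 5) (k : Fin 4) : A k = 0 := by
  set x : MvPolynomial (Fin 6) ℚ := X 0 + X 1 + X 5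
  set y : MvPolynomial (Fin 6) ℚ := X 0 + X 2 + X 4
  set z : MvPolynomial (Fin 6) ℚ := X 1 + X 2 + X 3
  set t : MvPolynomial (Fin 6) ℚ := X 3 + X 4 + X 5
  set D := (x - y) * (x - z) * (x - t) * (y - z) * (y - t) * (z - t) with hD
  have hD0 : D ≠ 0 := by
    intro h
    have := congrArg (eval ![0, 0, 0, 1, 2, 4]) h
    simp [hD, x, y, z, t] at this
    norm_num at this
  refine (mul_eq_zero.mp (MvPolynomial.funext fun d => ?_ : A k * D = 0)).resolve_right hD0
  by_cases hd : eval d D = 0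
  · simp [hd]
  have h₁ := h126 d
  have h₂ := h135 d
  have h₃ := h234 d
  have h₄ := h456 d
  simp only [quarticForm, zero_mul, Pi.zero_apply, Finset.sum_const_zero, mul_zero, zero_add,
    add_zero] at h₁ h₂ h₃ h₄
  obtain ⟨e₀, e₁, e₂, e₃⟩ := cubic_coeffs_eq_zero h₁ h₂ h₃ h₄
    (by simpa only [hD, x, y, z, t, map_mul, map_sub, map_add, eval_X] using hd)
  fin_cases k <;> simp [*]

lemma eval_eq_zero_of_aeval_eq_zero {σ τ : Type*} {f : σ → MvPolynomial τ ℚ}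
    {p : MvPolynomial σ ℚ} (h : aeval f p = 0) (v : τ → ℚ) :
    eval (fun i => eval v (f i)) p = 0 := by
  have := congrArg (aeval v) h
  rwa [map_zero, comp_aeval_apply] at this

/-- The point `(c₁, c₂, c₃, d₁, …, d₆)` of affine space. -/
def point (x y z : ℚ) (d : Fin 6 → ℚ) : Fin 9 → ℚ :=
  ![x, y, z, d 0, d 1, d 2, d 3, d 4, d 5]

/-- The intersection of the kernels of the restriction homomorphisms, in degree four. -/
noncomputable abbrev quarticKernel : Submodule ℚ (MvPolynomial (Fin 9) ℚ) :=
  weightedHomogeneousSubmodule ℚ wt 4 ⊓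
    LinearMap.ker φ126.toLinearMap ⊓ LinearMap.ker φ135.toLinearMap ⊓
    LinearMap.ker φ234.toLinearMap ⊓ LinearMap.ker φ456.toLinearMap

lemma eq_zero_of_mem_quarticKernel {p : MvPolynomial (Fin 9) ℚ} (hp : p ∈ quarticKernel)
    (h₁ : eval (point 1 0 0 0) p = 0) (h₂ : eval (point 0 1 0 0) p = 0) : p = 0 := by
  obtain ⟨⟨⟨⟨hw, h126⟩, h135⟩, h234⟩, h456⟩ := hp
  obtain ⟨l₀, l₁, l₂, l₃, a, b, q, A, hq, hA, hp⟩ := exists_eq_quarticForm hw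
  replace hp (x y z : ℚ) (d : Fin 6 → ℚ) :
      eval (point x y z d) p = quarticForm l₀ l₁ l₂ l₃ a b q A x y z d := by
    rw [← hp]
    congr 2
    funext i
    fin_cases i <;> rfl
  have hA' (k : Fin 4) : constantCoeff (A k) = 0 := by simpa [eval_zero] using hA k
  obtain rfl : l₀ = 0 := by simpa [quarticForm, hA'] using (hp 1 0 0 0).symm.trans h₁
  obtain rfl : l₂ = 0 := by simpa [quarticForm, hA'] using (hp 0 1 0 0).symm.trans h₂
  have v126 : VanishesOn (quarticForm 0 l₁ 0 l₃ a b q A) 0 1 5 := fun d => by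
    rw [← hp, ← eval_eq_zero_of_aeval_eq_zero h126 ![d 0, d 1, d 5, d 2, d 3, d 4]]
    congr 2
    funext i
    fin_cases i <;> simp [point]
  have v135 : VanishesOn (quarticForm 0 l₁ 0 l₃ a b q A) 0 2 4 := fun d => by
    rw [← hp, ← eval_eq_zero_of_aeval_eq_zero h135 ![d 0, d 2, d 4, d 1, d 3, d 5]]
    congr 2
    funext i
    fin_cases i <;> simp [point]
  have v234 : VanishesOn (quarticForm 0 l₁ 0 l₃ a b q A) 1 2 3 := fun d => by
    rw [← hp, ← eval_eq_zero_of_aeval_eq_zero h234 ![d 1, d 2, d 3, d 0, d 4, d 5]]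
    congr 2
    funext i
    fin_cases i <;> simp [point]
  have v456 : VanishesOn (quarticForm 0 l₁ 0 l₃ a b q A) 3 4 5 := fun d => by
    rw [← hp, ← eval_eq_zero_of_aeval_eq_zero h456 ![d 3, d 4, d 5, d 0, d 1, d 2]]
    congr 2
    funext i
    fin_cases i <;> simp [point]
  obtain ⟨rfl, rfl, rfl, rfl, rfl⟩ := lower_coeffs_eq_zero hq v126 v135 v234 v456
  have hA0 := polynomial_coeffs_eq_zero v126 v135 v234 v456
  refine MvPolynomial.funext fun v => ?_
  have hv : v = point (v 0) (v 1) (v 2) (fun i => v (Fin.natAdd 3 i)) := by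
    funext i
    fin_cases i <;> rfl
  rw [hv, hp]
  simp [quarticForm, hA0]

/-- The linear form `dᵢ + dⱼ + dₖ - c₁`. -/
noncomputable def lineForm (i j k : Fin 9) : MvPolynomial (Fin 9) ℚ := X i + X j + X k - X 0

/-- The elementary symmetric polynomials in a list of variables. -/
noncomputable def listEsymm : ℕ → List (Fin 9) → MvPolynomial (Fin 9) ℚ
  | 0, _ => 1
  | _ + 1, [] => 0
  | k + 1, i :: l => listEsymm (k + 1) l + X i * listEsymm k l

lemma isWeightedHomogeneous_listEsymm (k : ℕ) (l : List (Fin 9)) (hl : ∀ i ∈ l, wt i = 1) :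
    IsWeightedHomogeneous wt (listEsymm k l) k := by
  induction l generalizing k with
  | nil =>
    cases k with
    | zero => exact isWeightedHomogeneous_one ℚ wt
    | succ k => exact isWeightedHomogeneous_zero ℚ wt _
  | cons i l ih =>
    cases k with
    | zero => exact isWeightedHomogeneous_one ℚ wt
    | succ k =>
      have h := (isWeightedHomogeneous_X ℚ wt i).mul (ih k fun j hj => hl j (by simp [hj]))
      rw [hl i (by simp), add_comm] at h
      exact (ih (k + 1) fun j hj => hl j (by simp [hj])).add h

/-- The degree-four part of `∏ⱼ (1 - dⱼ) / (1 - c₁ + c₂ - c₃)`, which vanishes whenever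
`c₁, c₂, c₃` are the elementary symmetric polynomials in three of the `dⱼ`. -/
noncomputable def chernQuartic : MvPolynomial (Fin 9) ℚ :=
  let e := fun k => listEsymm k [3, 4, 5, 6, 7, 8]
  (X 0 ^ 4 - 3 * X 0 ^ 2 * X 1 + X 1 ^ 2 + 2 * X 0 * X 2) -
    (X 0 ^ 3 - 2 * X 0 * X 1 + X 2) * e 1 + (X 0 ^ 2 - X 1) * e 2 - X 0 * e 3 + e 4

lemma lineForm_prod_mem :
    lineForm 3 4 8 * lineForm 3 5 7 * lineForm 4 5 6 * lineForm 6 7 8 ∈ quarticKernel := by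
  have hl (i j k : Fin 9) (hi : wt i = 1) (hj : wt j = 1) (hk : wt k = 1) :
      IsWeightedHomogeneous wt (lineForm i j k) 1 := by
    have hX (m : Fin 9) (hm : wt m = 1) :
        IsWeightedHomogeneous wt (X m : MvPolynomial (Fin 9) ℚ) 1 :=
      hm ▸ isWeightedHomogeneous_X ℚ wt m
    exact (((hX i hi).add (hX j hj)).add (hX k hk)).sub (hX 0 rfl)
  have h126 : φ126 (lineForm 3 4 8) = 0 := by simp [φ126, lineForm]
  have h135 : φ135 (lineForm 3 5 7) = 0 := by simp [φ135, lineForm]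
  have h234 : φ234 (lineForm 4 5 6) = 0 := by simp [φ234, lineForm]
  have h456 : φ456 (lineForm 6 7 8) = 0 := by simp [φ456, lineForm]
  refine ⟨⟨⟨⟨?_, ?_⟩, ?_⟩, ?_⟩, ?_⟩
  · exact (((hl 3 4 8 rfl rfl rfl).mul (hl 3 5 7 rfl rfl rfl)).mul (hl 4 5 6 rfl rfl rfl)).mul
      (hl 6 7 8 rfl rfl rfl)
  all_goals simp [h126, h135, h234, h456]

lemma chernQuartic_mem : chernQuartic ∈ quarticKernel := by
  refine ⟨⟨⟨⟨?_, ?_⟩, ?_⟩, ?_⟩, ?_⟩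
  · have h0 : IsWeightedHomogeneous wt (X 0 : MvPolynomial (Fin 9) ℚ) 1 :=
      isWeightedHomogeneous_X ℚ wt 0
    have h1 : IsWeightedHomogeneous wt (X 1 : MvPolynomial (Fin 9) ℚ) 2 :=
      isWeightedHomogeneous_X ℚ wt 1
    have h2 : IsWeightedHomogeneous wt (X 2 : MvPolynomial (Fin 9) ℚ) 3 :=
      isWeightedHomogeneous_X ℚ wt 2
    have hn (n : ℕ) [n.AtLeastTwo] :
        IsWeightedHomogeneous wt (OfNat.ofNat n : MvPolynomial (Fin 9) ℚ) 0 :=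
      isWeightedHomogeneous_C wt (OfNat.ofNat n : ℚ)
    have he (k : ℕ) := isWeightedHomogeneous_listEsymm k [3, 4, 5, 6, 7, 8] (by decide)
    exact ((((((h0.pow 4).sub (((hn 3).mul (h0.pow 2)).mul h1)).add (h1.pow 2)).add
      (((hn 2).mul h0).mul h2)).sub ((((h0.pow 3).sub (((hn 2).mul h0).mul h1)).add h2).mul
      (he 1))).add (((h0.pow 2).sub h1).mul (he 2))).sub (h0.mul (he 3)) |>.add (he 4)
  · change φ126 chernQuartic = 0
    simp only [φ126, chernQuartic, listEsymm, map_add, map_sub, map_mul, map_pow, map_ofNat, map_one,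
      map_zero, aeval_X, Matrix.cons_val]
    ring
  · change φ135 chernQuartic = 0
    simp only [φ135, chernQuartic, listEsymm, map_add, map_sub, map_mul, map_pow, map_ofNat, map_one,
      map_zero, aeval_X, Matrix.cons_val]
    ring
  · change φ234 chernQuartic = 0
    simp only [φ234, chernQuartic, listEsymm, map_add, map_sub, map_mul, map_pow, map_ofNat, map_one,
      map_zero, aeval_X, Matrix.cons_val]
    ring
  · change φ456 chernQuartic = 0
    simp only [φ456, chernQuartic, listEsymm, map_add, map_sub, map_mul, map_pow, map_ofNat, map_one,
      map_zero, aeval_X, Matrix.cons_val]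
    ring

/-- The space of homogeneous degree-4 polynomials in the intersection of the kernels
of the four restriction homomorphisms `φ_{1|2|6}, φ_{1|3|5}, φ_{2|3|4}, φ_{4|5|6}`
is 2-dimensional over `ℚ`. -/
theorem dim_four_kernels_eq_two :
    Module.finrank ℚ
      ↥(weightedHomogeneousSubmodule ℚ wt 4 ⊓
        LinearMap.ker φ126.toLinearMap ⊓ LinearMap.ker φ135.toLinearMap ⊓
        LinearMap.ker φ234.toLinearMap ⊓ LinearMap.ker φ456.toLinearMap) = 2 := by
  let f (v : Fin 9 → ℚ) : quarticKernel →ₗ[ℚ] ℚ :=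
    (aeval v).toLinearMap ∘ₗ quarticKernel.subtype
  have hf (v : Fin 9 → ℚ) (p : quarticKernel) : f v p = eval v p.1 := by
    simp [f, aeval_eq_eval]
  let F := (f (point 1 0 0 0)).prod (f (point 0 1 0 0))
  have hinj : Function.Injective F := by
    refine (injective_iff_map_eq_zero F).mpr fun p hp => Subtype.ext ?_
    have h := Prod.ext_iff.mp hp
    exact eq_zero_of_mem_quarticKernel p.2 ((hf _ p).symm.trans h.1) ((hf _ p).symm.trans h.2)
  have hsurj : Function.Surjective F := fun ⟨s, t⟩ => by
    refine ⟨(s - t) • ⟨_, lineForm_prod_mem⟩ + t • ⟨_, chernQuartic_mem⟩, ?_⟩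
    ext <;> simp [F, hf, point, lineForm, chernQuartic, listEsymm]
  have h := (LinearEquiv.ofBijective F ⟨hinj, hsurj⟩).finrank_eq
  rwa [Module.finrank_prod, Module.finrank_self] at h
end

section
/- Let X ⊆ ℂ^{2×6} be the set of matrices M, with columns v1, …, v6 ∈ ℂ², such that: v1, v2, v3 are nonzero and pairwise proportional; v4, v5 are nonzero and proportional; v1 and v4 are linearly independent; and v6 = 0. Then the Zariski closure of X in ℂ^{2×6} (the set of matrices at which every polynomial in the 12 entries vanishing identically on X vanishes) is exactly the set of matrices M ∈ ℂ^{2×6} such that the 2×3 submatrix on columns 1, 2, 3 has rank at most 1, the 2×2 submatrix on columns 4, 5 has rank at most 1, and the sixth column is zero. -/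
/-- Two vectors of `ℂ²` are proportional: one is a scalar multiple of the other. -/
def Proportional (u v : Fin 2 → ℂ) : Prop :=
  ∃ c : ℂ, v = c • u ∨ u = c • v

/-- The set `X_C` for the configuration `C` of Example 2.2: matrices in `ℂ^{2×6}`
whose columns `v₁,…,v₆` satisfy: `v₁, v₂, v₃` are nonzero and pairwise proportional,
`v₄, v₅` are nonzero and proportional, `v₁` and `v₄` are linearly independent,
and `v₆ = 0`. -/
def X10 : Set (Matrix (Fin 2) (Fin 6) ℂ) :=
  {M | (fun r => M r 0) ≠ 0 ∧ (fun r => M r 1) ≠ 0 ∧ (fun r => M r 2) ≠ 0 ∧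
    Proportional (fun r => M r 0) (fun r => M r 1) ∧
    Proportional (fun r => M r 0) (fun r => M r 2) ∧
    Proportional (fun r => M r 1) (fun r => M r 2) ∧
    (fun r => M r 3) ≠ 0 ∧ (fun r => M r 4) ≠ 0 ∧
    Proportional (fun r => M r 3) (fun r => M r 4) ∧
    LinearIndependent ℂ ![fun r => M r 0, fun r => M r 3] ∧
    (fun r => M r 5) = 0}

/-- The Zariski closure of `X10` in `ℂ^{2×6}`: the set of matrices at which every
polynomial in the 12 entries vanishing identically on `X10` vanishes. -/
def Y10 : Set (Matrix (Fin 2) (Fin 6) ℂ) :=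
  {M | ∀ p : MvPolynomial (Fin 2 × Fin 6) ℂ,
    (∀ N ∈ X10, MvPolynomial.eval (fun q => N q.1 q.2) p = 0) →
    MvPolynomial.eval (fun q => M q.1 q.2) p = 0}

open Polynomial in
/-- A multivariate polynomial vanishing at the generic points of a polynomial curve vanishes on
the whole curve. -/
theorem MvPolynomial.eval_eq_zero_of_generic_on_curve {K σ : Type*} [Field K] [Infinite K]
    (p : MvPolynomial σ K) (γ : σ → K[X]) {f : K[X]} (hf : f ≠ 0)
    (h : ∀ t, f.eval t ≠ 0 → MvPolynomial.eval (fun s => (γ s).eval t) p = 0) (t : K) :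
    MvPolynomial.eval (fun s => (γ s).eval t) p = 0 := by
  have key : ∀ t, (MvPolynomial.aeval γ p).eval t =
      MvPolynomial.eval (fun s => (γ s).eval t) p := fun t => by
    rw [MvPolynomial.aeval_def, MvPolynomial.polynomial_eval_eval₂, ← MvPolynomial.eval₂_id]
    congr 1
    ext
    simp
  have hmul : MvPolynomial.aeval γ p * f = 0 := Polynomial.funext fun t => by
    by_cases ht : f.eval t = 0
    · simp [ht]
    · simp [key, h t ht]
  rw [← key, (mul_eq_zero.mp hmul).resolve_right hf, Polynomial.eval_zero]

/-- A matrix of rank at most one is an outer product. -/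
theorem Matrix.exists_eq_vecMulVec_of_rank_le_one {K m n : Type*} [Field K] [Fintype m]
    [Fintype n] {A : Matrix m n K} (hA : A.rank ≤ 1) :
    ∃ (u : m → K) (a : n → K), A = Matrix.vecMulVec u a := by
  rw [Matrix.rank_eq_finrank_span_cols, Submodule.finrank_le_one_iff_isPrincipal] at hA
  obtain ⟨u, hu⟩ := hA.principal
  have hcol : ∀ j, ∃ c : K, c • u = A.col j := fun j =>
    Submodule.mem_span_singleton.mp (hu ▸ Submodule.subset_span ⟨j, rfl⟩)
  choose a ha using hcol
  refine ⟨u, a, Matrix.ext fun i j => ?_⟩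
  rw [Matrix.vecMulVec_apply, mul_comm, ← smul_eq_mul, ← Pi.smul_apply, ha, Matrix.col_apply]

/-- A matrix all of whose `2 × 2` minors vanish has rank at most one. -/
theorem Matrix.rank_le_one_of_minors_eq_zero {K m n : Type*} [Field K] [Fintype n]
    {A : Matrix m n K} (hA : ∀ i i' j j', A i j * A i' j' = A i j' * A i' j) : A.rank ≤ 1 := by
  by_cases h : A = 0
  · simp [h]
  · obtain ⟨i, j, hij⟩ : ∃ i j, A i j ≠ 0 := by
      by_contra! h'
      exact h (Matrix.ext h')
    have : A = Matrix.vecMulVec (fun r => A r j) (fun s => A i s / A i j) := by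
      ext r s
      rw [Matrix.vecMulVec_apply, mul_div_assoc', eq_div_iff hij, hA r i s j]
    rw [this]
    exact Matrix.rank_vecMulVec_le _ _

theorem Proportional.cross_mul_eq {u v : Fin 2 → ℂ} (h : Proportional u v) :
    u 0 * v 1 = u 1 * v 0 := by
  obtain ⟨c, rfl | rfl⟩ := h <;> simp only [Pi.smul_apply, smul_eq_mul] <;> ring

theorem proportional_smul_smul {a b : ℂ} (ha : a ≠ 0) (u : Fin 2 → ℂ) :
    Proportional (a • u) (b • u) :=
  ⟨b / a, Or.inl (by rw [smul_smul, div_mul_cancel₀ _ ha])⟩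

/-- The matrix with columns `a₀u, a₁u, a₂u, b₀w, b₁w, 0`. -/
def twoLinesMatrix {R : Type*} [CommRing R] (u w : Fin 2 → R) (a : Fin 3 → R)
    (b : Fin 2 → R) : Matrix (Fin 2) (Fin 6) R :=
  Matrix.of fun r => ![a 0 * u r, a 1 * u r, a 2 * u r, b 0 * w r, b 1 * w r, 0]

theorem twoLinesMatrix_mem_X10 {u w : Fin 2 → ℂ} {a : Fin 3 → ℂ} {b : Fin 2 → ℂ}
    (ha : ∀ i, a i ≠ 0) (hb : ∀ i, b i ≠ 0) (huw : u 0 * w 1 - u 1 * w 0 ≠ 0) :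
    twoLinesMatrix u w a b ∈ X10 := by
  have hu : u ≠ 0 := by rintro rfl; simp at huw
  have hw : w ≠ 0 := by rintro rfl; simp at huw
  refine ⟨smul_ne_zero (ha 0) hu, smul_ne_zero (ha 1) hu, smul_ne_zero (ha 2) hu,
    proportional_smul_smul (ha 0) u, proportional_smul_smul (ha 0) u,
    proportional_smul_smul (ha 1) u, smul_ne_zero (hb 0) hw, smul_ne_zero (hb 1) hw,
    proportional_smul_smul (hb 0) w, ?_, rfl⟩
  change LinearIndependent ℂ ![a 0 • u, b 0 • w]
  refine LinearIndependent.pair_iff.mpr fun s t hst => ?_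
  have h0 : s * (a 0 * u 0) + t * (b 0 * w 0) = 0 := congrFun hst 0
  have h1 : s * (a 0 * u 1) + t * (b 0 * w 1) = 0 := congrFun hst 1
  constructor
  · have : s * (a 0 * (u 0 * w 1 - u 1 * w 0)) = 0 := by
      linear_combination w 1 * h0 - w 0 * h1
    exact (mul_eq_zero.mp this).resolve_right (mul_ne_zero (ha 0) huw)
  · have : t * (b 0 * (u 0 * w 1 - u 1 * w 0)) = 0 := by
      linear_combination u 0 * h1 - u 1 * h0
    exact (mul_eq_zero.mp this).resolve_right (mul_ne_zero (hb 0) huw)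

open Polynomial in
theorem twoLinesMatrix_mem_Y10 (u w : Fin 2 → ℂ) (a : Fin 3 → ℂ) (b : Fin 2 → ℂ) :
    twoLinesMatrix u w a b ∈ Y10 := by
  intro p hp
  let U : Fin 2 → ℂ[X] := ![X + C (u 0), C (u 1)]
  let W : Fin 2 → ℂ[X] := ![C (w 0), X + C (w 1)]
  let A : Fin 3 → ℂ[X] := fun i => X + C (a i)
  let B : Fin 2 → ℂ[X] := fun i => X + C (b i)
  let D : ℂ[X] := X ^ 2 + (C (u 0 + w 1) * X + C (u 0 * w 1 - u 1 * w 0))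
  have hD : D ≠ 0 := (monic_X_pow_add (n := 2) (degree_linear_lt)).ne_zero
  have hf : (∏ i, A i) * (∏ i, B i) * D ≠ 0 :=
    mul_ne_zero (mul_ne_zero (Finset.prod_ne_zero_iff.mpr fun i _ => X_add_C_ne_zero _)
      (Finset.prod_ne_zero_iff.mpr fun i _ => X_add_C_ne_zero _)) hD
  have hcurve : ∀ t, (fun q : Fin 2 × Fin 6 => (twoLinesMatrix U W A B q.1 q.2).eval t) =
      fun q => twoLinesMatrix (fun r => (U r).eval t) (fun r => (W r).eval t)
        (fun i => (A i).eval t) (fun i => (B i).eval t) q.1 q.2 := fun t => by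
    ext ⟨r, s⟩
    fin_cases s <;> simp [twoLinesMatrix]
  have hzero := MvPolynomial.eval_eq_zero_of_generic_on_curve p
    (fun q => twoLinesMatrix U W A B q.1 q.2) hf (fun t ht => by
      simp only [hcurve]
      simp only [eval_mul, eval_prod, mul_ne_zero_iff, Finset.prod_ne_zero_iff] at ht
      refine hp _ (twoLinesMatrix_mem_X10 (fun i => ht.1.1 i (Finset.mem_univ i))
        (fun i => ht.1.2 i (Finset.mem_univ i)) fun h => ht.2 ?_)
      simp only [U, W, Matrix.cons_val_zero, Matrix.cons_val_one, eval_add, eval_X, eval_C] at h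
      simp only [D, eval_add, eval_mul, eval_pow, eval_X, eval_C]
      linear_combination h) 0
  have hU : (fun r => (U r).eval 0) = u := by ext r; fin_cases r <;> simp [U]
  have hW : (fun r => (W r).eval 0) = w := by ext r; fin_cases r <;> simp [W]
  have hA : (fun i => (A i).eval 0) = a := by simp [A]
  have hB : (fun i => (B i).eval 0) = b := by simp [B]
  simpa only [hcurve, hU, hW, hA, hB] using hzero

theorem cross_mul_eq_of_mem_Y10 {i j : Fin 6}
    (h : ∀ N ∈ X10, N 0 i * N 1 j = N 1 i * N 0 j) {M : Matrix (Fin 2) (Fin 6) ℂ}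
    (hM : M ∈ Y10) : M 0 i * M 1 j = M 1 i * M 0 j := by
  have := hM (.X (0, i) * .X (1, j) - .X (1, i) * .X (0, j)) fun N hN => by
    simp [h N hN]
  simpa [sub_eq_zero] using this

/-- The Zariski closure of `X10` is exactly the set of matrices whose first three
columns span a line at most (rank `≤ 1`), whose fourth and fifth columns span a line
at most, and whose sixth column is zero. -/
theorem closure_eq_closed_conditions :
    Y10 = {M : Matrix (Fin 2) (Fin 6) ℂ |
      (M.submatrix id ![0, 1, 2]).rank ≤ 1 ∧
      (M.submatrix id ![3, 4]).rank ≤ 1 ∧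
      (fun r => M r 5) = 0} := by
  ext M
  constructor
  · intro hM
    have h01 := cross_mul_eq_of_mem_Y10 (i := 0) (j := 1)
      (fun N hN => hN.2.2.2.1.cross_mul_eq) hM
    have h02 := cross_mul_eq_of_mem_Y10 (i := 0) (j := 2)
      (fun N hN => hN.2.2.2.2.1.cross_mul_eq) hM
    have h12 := cross_mul_eq_of_mem_Y10 (i := 1) (j := 2)
      (fun N hN => hN.2.2.2.2.2.1.cross_mul_eq) hM
    have h34 := cross_mul_eq_of_mem_Y10 (i := 3) (j := 4)
      (fun N hN => hN.2.2.2.2.2.2.2.2.1.cross_mul_eq) hM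
    refine ⟨Matrix.rank_le_one_of_minors_eq_zero ?_, Matrix.rank_le_one_of_minors_eq_zero ?_,
      funext fun r => ?_⟩
    · simp [Fin.forall_fin_succ]
      grind
    · simp [Fin.forall_fin_succ]
      grind
    · simpa using hM (.X (r, 5)) fun N hN => by
        simpa using congrFun hN.2.2.2.2.2.2.2.2.2.2 r
  · rintro ⟨h₁, h₂, h₃⟩
    obtain ⟨u, a, hu⟩ := Matrix.exists_eq_vecMulVec_of_rank_le_one h₁
    obtain ⟨w, b, hw⟩ := Matrix.exists_eq_vecMulVec_of_rank_le_one h₂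
    have hM : M = twoLinesMatrix u w a b := by
      ext r s
      have hu' := congrFun (congrFun hu r)
      have hw' := congrFun (congrFun hw r)
      simp only [Matrix.submatrix_apply, Matrix.vecMulVec_apply, mul_comm (u r)] at hu'
      simp only [Matrix.submatrix_apply, Matrix.vecMulVec_apply, mul_comm (w r)] at hw'
      fin_cases s
      · exact hu' 0
      · exact hu' 1
      · exact hu' 2
      · exact hw' 0
      · exact hw' 1
      · exact congrFun h₃ r
    exact hM ▸ twoLinesMatrix_mem_Y10 u w a b
end
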